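/- Fix σ > 0 and c > 0. There exist K > 0 and an integer k₀ such that for all integers k ≥ k₀ and all integers n with 0 ≤ n ≤ c·k, the k-th positive zero κ_{n,k} of φ_{n,σ} satisfies |κ_{n,k} − F(n, k − 3/4)| ≤ K/k. -/

import Mathlib

open Real MeasureTheory

/-- The Bessel function of integer order `n`: `J_n(x) = (1/π)∫₀^π cos(x sin t − n t) dt`. -/
noncomputable def besselJ (n : ℕ) (x : ℝ) : ℝ :=
  (1 / π) * ∫ t in (0:ℝ)..π, Real.cos (x * Real.sin t - n * t)

/-- The derivative `J_n′` of the Bessel function. -/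
noncomputable def besselJ' (n : ℕ) (x : ℝ) : ℝ := deriv (besselJ n) x

/-- `φ_{n,σ}(x) = x·J_n′(x) + σ·J_n(x)`. -/
noncomputable def phiRobin (σ : ℝ) (n : ℕ) (x : ℝ) : ℝ :=
  x * besselJ' n x + σ * besselJ n x

/-- `g(x) = (1/π)(√(1−x²) − x·arccos x)`. -/
noncomputable def gfun (x : ℝ) : ℝ :=
  (1 / π) * (Real.sqrt (1 - x ^ 2) - x * Real.arccos x)

open Set Filter Topology

lemma hasDerivAt_param {E : Type*} [NormedAddCommGroup E] [NormedSpace ℝ E]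
    (F F' : ℝ → ℝ → E) (a b : ℝ)
    (hF : Continuous (fun p : ℝ × ℝ => F p.1 p.2))
    (hF' : Continuous (fun p : ℝ × ℝ => F' p.1 p.2))
    (hd : ∀ x t, HasDerivAt (fun x => F x t) (F' x t) x) (x₀ : ℝ) :
    HasDerivAt (fun x => ∫ t in a..b, F x t) (∫ t in a..b, F' x₀ t) x₀ := by
  have hK : IsCompact (Icc (x₀ - 1) (x₀ + 1) ×ˢ uIcc a b) := isCompact_Icc.prod isCompact_uIcc
  obtain ⟨C, hC⟩ := hK.exists_bound_of_continuousOn hF'.continuousOn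
  refine (intervalIntegral.hasDerivAt_integral_of_dominated_loc_of_deriv_le
    (F := F) (F' := F') (s := Icc (x₀ - 1) (x₀ + 1)) (bound := fun _ => C)
    (Icc_mem_nhds (by linarith) (by linarith)) ?_ ?_ ?_ ?_ ?_ ?_).2
  · refine Eventually.of_forall fun x => ?_
    exact (hF.comp (by fun_prop : Continuous fun t : ℝ => (x, t))).aestronglyMeasurable
  · exact (hF.comp (by fun_prop : Continuous fun t : ℝ => (x₀, t))).intervalIntegrable _ _
  · exact (hF'.comp (by fun_prop : Continuous fun t : ℝ => (x₀, t))).aestronglyMeasurable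
  · refine Eventually.of_forall fun t ht x hx => ?_
    exact hC (x, t) ⟨hx, uIoc_subset_uIcc ht⟩
  · exact intervalIntegrable_const
  · exact Eventually.of_forall fun t ht x hx => hd x t

lemma bj_hasDeriv0 (n : ℕ) (x : ℝ) :
    HasDerivAt (besselJ n)
      ((1 / π) * ∫ t in (0:ℝ)..π, -Real.sin (x * Real.sin t - n * t) * Real.sin t) x := by
  have := hasDerivAt_param (fun x t => Real.cos (x * Real.sin t - n * t))
    (fun x t => -Real.sin (x * Real.sin t - n * t) * Real.sin t) 0 π (by fun_prop) (by fun_prop)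
    (fun x t => by
      have h1 : HasDerivAt (fun x : ℝ => x * Real.sin t - n * t) (Real.sin t) x := by
        simpa using ((hasDerivAt_id x).mul_const (Real.sin t)).sub_const (n * t : ℝ)
      exact h1.cos) x
  exact this.const_mul (1 / π)

lemma bj_cos_int (n : ℕ) (x : ℝ) :
    x * ((1 / π) * ∫ t in (0:ℝ)..π, Real.cos (x * Real.sin t - n * t) * Real.cos t)
      = n * besselJ n x := by
  have h : ∫ t in (0:ℝ)..π, Real.cos (x * Real.sin t - n * t) * (x * Real.cos t - n) = 0 := by
    rw [intervalIntegral.integral_eq_sub_of_hasDerivAt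
      (f := fun t => Real.sin (x * Real.sin t - n * t))]
    · simp
    · intro t _
      have h1 : HasDerivAt (fun t : ℝ => x * Real.sin t - n * t) (x * Real.cos t - n) t := by
        simpa using ((Real.hasDerivAt_sin t).const_mul x).fun_sub ((hasDerivAt_id t).const_mul (n:ℝ))
      exact h1.sin
    · exact (by fun_prop : Continuous _).intervalIntegrable _ _
  have h2 : ∫ t in (0:ℝ)..π, Real.cos (x * Real.sin t - n * t) * (x * Real.cos t - n)
      = x * (∫ t in (0:ℝ)..π, Real.cos (x * Real.sin t - n * t) * Real.cos t)
        - n * ∫ t in (0:ℝ)..π, Real.cos (x * Real.sin t - n * t) := by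
    rw [← intervalIntegral.integral_const_mul, ← intervalIntegral.integral_const_mul,
      ← intervalIntegral.integral_sub]
    · congr 1; ext t; ring
    · exact (by fun_prop : Continuous _).intervalIntegrable _ _
    · exact (by fun_prop : Continuous _).intervalIntegrable _ _
  rw [h] at h2
  unfold besselJ
  linear_combination (-(1/π)) * h2

lemma bj_rec1 (n : ℕ) (x : ℝ) :
    x * deriv (besselJ n) x = n * besselJ n x - x * besselJ (n+1) x := by
  rw [← bj_cos_int, (bj_hasDeriv0 n x).deriv]
  have : besselJ (n+1) x = (1 / π) * (∫ t in (0:ℝ)..π, Real.cos (x * Real.sin t - n * t) * Real.cos t)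
      - (1 / π) * ∫ t in (0:ℝ)..π, -Real.sin (x * Real.sin t - n * t) * Real.sin t := by
    unfold besselJ
    rw [← mul_sub, ← intervalIntegral.integral_sub]
    · congr 2; ext t
      have : x * Real.sin t - ((n+1:ℕ):ℝ) * t = (x * Real.sin t - n * t) - t := by push_cast; ring
      rw [this, Real.cos_sub]; ring
    · exact (by fun_prop : Continuous _).intervalIntegrable _ _
    · exact (by fun_prop : Continuous _).intervalIntegrable _ _
  rw [this]; ring

lemma bj_rec2 (n : ℕ) (x : ℝ) :
    x * deriv (besselJ (n+1)) x = x * besselJ n x - (n+1) * besselJ (n+1) x := by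
  have h0 := bj_cos_int (n+1) x
  push_cast at h0
  rw [← h0, (bj_hasDeriv0 (n+1) x).deriv]
  have : besselJ n x = (1 / π) * (∫ t in (0:ℝ)..π, Real.cos (x * Real.sin t - (n+1) * t) * Real.cos t)
      + (1 / π) * ∫ t in (0:ℝ)..π, -Real.sin (x * Real.sin t - (n+1) * t) * Real.sin t := by
    unfold besselJ
    rw [← mul_add, ← intervalIntegral.integral_add]
    · congr 2; ext t
      have : x * Real.sin t - (n:ℝ) * t = (x * Real.sin t - (n+1) * t) + t := by ring
      rw [this, Real.cos_add]; ring
    · exact (by fun_prop : Continuous _).intervalIntegrable _ _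
    · exact (by fun_prop : Continuous _).intervalIntegrable _ _
  rw [this]; push_cast; ring

lemma bj_diff (n : ℕ) (x : ℝ) : DifferentiableAt ℝ (besselJ n) x :=
  (bj_hasDeriv0 n x).differentiableAt

lemma bj_cont (n : ℕ) : Continuous (besselJ n) :=
  continuous_iff_continuousAt.2 fun x => (bj_diff n x).continuousAt

lemma bj_d1 (n : ℕ) {x : ℝ} (hx : 0 < x) :
    HasDerivAt (besselJ n) (n / x * besselJ n x - besselJ (n+1) x) x := by
  have h := (bj_diff n x).hasDerivAt
  have h2 := bj_rec1 n x
  have : deriv (besselJ n) x = n / x * besselJ n x - besselJ (n+1) x := by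
    field_simp; linarith
  rwa [this] at h

lemma bj_d2 (n : ℕ) {x : ℝ} (hx : 0 < x) :
    HasDerivAt (besselJ (n+1)) (besselJ n x - (n+1) / x * besselJ (n+1) x) x := by
  have h := (bj_diff (n+1) x).hasDerivAt
  have h2 := bj_rec2 n x
  have : deriv (besselJ (n+1)) x = besselJ n x - (n+1) / x * besselJ (n+1) x := by
    field_simp; linarith
  rwa [this] at h

lemma bj_three (n : ℕ) {x : ℝ} (hx : 0 < x) :
    besselJ (n+2) x = 2 * (n+1) / x * besselJ (n+1) x - besselJ n x := by
  have h := (bj_d1 (n+1) hx).unique (bj_d2 n hx)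
  push_cast at h
  have : (n + 1 : ℝ)/x * besselJ (n+1) x - besselJ (n+1+1) x = besselJ n x - (n+1) / x * besselJ (n+1) x := h
  have e : 2 * ((n:ℝ)+1) / x = 2 * ((n+1)/x) := by ring
  rw [e]; linarith

lemma phi_eq (σ : ℝ) (n : ℕ) (x : ℝ) :
    phiRobin σ n x = (n + σ) * besselJ n x - x * besselJ (n+1) x := by
  unfold phiRobin besselJ'
  rw [bj_rec1]; ring

lemma bj_zero_pos {x : ℝ} (h0 : 0 ≤ x) (h1 : x ≤ 1) : 0 < besselJ 0 x := by
  unfold besselJ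
  refine mul_pos (by positivity) ?_
  apply intervalIntegral.intervalIntegral_pos_of_pos_on
  · exact (by fun_prop : Continuous _).intervalIntegrable _ _
  · intro t ht
    apply Real.cos_pos_of_mem_Ioo
    have hs0 := Real.sin_pos_of_mem_Ioo ht
    have hs1 := Real.sin_le_one t
    have := Real.pi_gt_three
    constructor
    · simp; nlinarith
    · simp; nlinarith
  · exact Real.pi_pos

lemma bj_at_zero (n : ℕ) (hn : n ≠ 0) : besselJ n 0 = 0 := by
  have := bj_rec1 n 0
  simp at this
  rcases this with h | h
  · exact absurd h hn
  · exact h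

lemma bj_pos_one (n : ℕ) : ∀ x : ℝ, 0 < x → x ≤ 1 → 0 < besselJ n x := by
  induction n with
  | zero => intro x h0 h1; exact bj_zero_pos h0.le h1
  | succ n ih =>
    intro x h0 h1
    have hm : StrictMonoOn (fun x : ℝ => x^(n+1) * besselJ (n+1) x) (Icc 0 1) := by
      apply strictMonoOn_of_deriv_pos (convex_Icc 0 1)
      · exact ((continuous_id.pow _).mul (bj_cont _)).continuousOn
      · intro y hy
        rw [interior_Icc] at hy
        have hd := (hasDerivAt_pow (n+1) y).fun_mul (bj_d2 n hy.1)
        have : HasDerivAt (fun x : ℝ => x^(n+1) * besselJ (n+1) x) (y^(n+1) * besselJ n y) y := by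
          refine hd.congr_deriv ?_
          have : y ≠ 0 := hy.1.ne'
          push_cast
          try simp
          field_simp
          ring
        rw [this.deriv]
        exact mul_pos (pow_pos hy.1 _) (ih y hy.1 hy.2.le)
    have := hm (left_mem_Icc.2 zero_le_one) ⟨h0.le, h1⟩ h0
    simp at this
    exact (pos_iff_pos_of_mul_pos this).1 (pow_pos h0 _)

lemma bj_norm_pos (n : ℕ) {x : ℝ} (hx : 0 < x) :
    0 < besselJ n x ^ 2 + besselJ (n+1) x ^ 2 := by
  have hm : MonotoneOn (fun x : ℝ => x^(2*n+2) * (besselJ n x ^ 2 + besselJ (n+1) x ^ 2)) (Ici 0) := by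
    apply monotoneOn_of_deriv_nonneg (convex_Ici 0)
    · exact ((continuous_id.pow _).mul (((bj_cont _).pow 2).add ((bj_cont _).pow 2))).continuousOn
    · intro y hy
      rw [interior_Ici] at hy
      have hy : 0 < y := hy
      exact ((hasDerivAt_pow (2*n+2) y).fun_mul (((bj_d1 n hy).fun_pow 2).fun_add ((bj_d2 n hy).fun_pow 2))).differentiableAt.differentiableWithinAt
    · intro y hy
      rw [interior_Ici] at hy
      have hy : 0 < y := hy
      have hd := (hasDerivAt_pow (2*n+2) y).fun_mul (((bj_d1 n hy).fun_pow 2).fun_add ((bj_d2 n hy).fun_pow 2))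
      have : HasDerivAt (fun x : ℝ => x^(2*n+2) * (besselJ n x ^ 2 + besselJ (n+1) x ^ 2))
          (y^(2*n+1) * ((4 * n + 2) * besselJ n y ^ 2)) y := by
        refine hd.congr_deriv ?_
        have : y ≠ 0 := hy.ne'
        push_cast
        try simp
        field_simp
        ring
      rw [this.deriv]; positivity
  by_cases h : x ≤ 1
  · have := bj_pos_one n x hx h
    positivity
  · push Not at h
    have h2 := hm (a := 1) (b := x) (by simp) hx.le h.le
    have := bj_pos_one n 1 one_pos le_rfl
    simp at h2
    have h3 : 0 < x^(2*n+2) * (besselJ n x ^ 2 + besselJ (n+1) x ^ 2) := lt_of_lt_of_le (by positivity) h2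
    exact (pos_iff_pos_of_mul_pos h3).1 (pow_pos hx _)

/-- IVT helper. -/
lemma lt_of_ne_conn {S : Set ℝ} (hS : IsPreconnected S) {f : ℝ → ℝ} (hf : ContinuousOn f S) {c : ℝ}
    (hne : ∀ x ∈ S, f x ≠ c) {x₀ : ℝ} (hx₀ : x₀ ∈ S) (h : f x₀ < c) : ∀ x ∈ S, f x < c := by
  intro x hx
  by_contra hcon
  push Not at hcon
  obtain ⟨y, hy, hyc⟩ := hS.intermediate_value hx₀ hx hf ⟨h.le, hcon⟩
  exact hne y hy hyc

lemma gt_of_ne_conn {S : Set ℝ} (hS : IsPreconnected S) {f : ℝ → ℝ} (hf : ContinuousOn f S) {c : ℝ}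
    (hne : ∀ x ∈ S, f x ≠ c) {x₀ : ℝ} (hx₀ : x₀ ∈ S) (h : c < f x₀) : ∀ x ∈ S, c < f x := by
  intro x hx
  by_contra hcon
  push Not at hcon
  obtain ⟨y, hy, hyc⟩ := hS.intermediate_value hx hx₀ hf ⟨hcon, h.le⟩
  exact hne y hy hyc

/-- `J_n > 0` and `x J_n' > 0` on `(0,n]`. -/
lemma bj_pos_n (n : ℕ) (hn : 1 ≤ n) (x : ℝ) (h0 : 0 < x) (h1 : x ≤ n) :
    0 < besselJ n x ∧ 0 < n * besselJ n x - x * besselJ (n+1) x := by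
  have hn0 : n ≠ 0 := by omega
  have hn1 : (1:ℝ) ≤ n := by exact_mod_cast hn
  have hpd : ∀ y : ℝ, 0 < y → HasDerivAt (fun x => n * besselJ n x - x * besselJ (n+1) x)
      ((n^2 - y^2)/y * besselJ n y) y := by
    intro y hy
    have := ((bj_d1 n hy).const_mul (n:ℝ)).fun_sub ((hasDerivAt_id y).fun_mul (bj_d2 n hy))
    refine this.congr_deriv ?_
    try simp
    field_simp
    ring
  have hpc : Continuous (fun x => n * besselJ n x - x * besselJ (n+1) x) :=
    (continuous_const.mul (bj_cont n)).sub (continuous_id.mul (bj_cont (n+1)))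
  have hm1 : MonotoneOn (fun x => besselJ n x * (n * besselJ n x - x * besselJ (n+1) x)) (Icc 0 n) := by
    apply monotoneOn_of_deriv_nonneg (convex_Icc 0 _) ((bj_cont n).mul hpc : Continuous fun x => besselJ n x * (n * besselJ n x - x * besselJ (n+1) x)).continuousOn
    · intro y hy
      rw [interior_Icc] at hy
      exact ((bj_d1 n hy.1).fun_mul (hpd y hy.1)).differentiableAt.differentiableWithinAt
    · intro y hy
      rw [interior_Icc] at hy
      rw [((bj_d1 n hy.1).mul (hpd y hy.1)).deriv]
      have hy0 := hy.1
      have e : (↑n / y * besselJ n y - besselJ (n + 1) y) * (n * besselJ n y - y * besselJ (n+1) y)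
        + besselJ n y * ((n^2 - y^2)/y * besselJ n y)
        = ((n * besselJ n y - y * besselJ (n+1) y)^2 + (n^2 - y^2) * besselJ n y ^2)/y := by
        field_simp
      rw [e]
      have : (0:ℝ) ≤ n^2 - y^2 := by nlinarith [hy.2]
      positivity
  have hjp : ∀ y : ℝ, 0 < y → y ≤ n → 0 ≤ besselJ n y * (n * besselJ n y - y * besselJ (n+1) y) := by
    intro y hy hyn
    have := hm1 (left_mem_Icc.2 (by linarith)) ⟨hy.le, hyn⟩ hy.le
    simpa [bj_at_zero n hn0] using this
  have hm2 : MonotoneOn (fun x => besselJ n x ^ 2) (Icc 0 n) := by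
    apply monotoneOn_of_deriv_nonneg (convex_Icc 0 _) ((bj_cont n).pow 2 : Continuous fun x => besselJ n x ^ 2).continuousOn
    · intro y hy
      exact ((bj_diff n y).fun_pow 2).differentiableWithinAt
    · intro y hy
      rw [interior_Icc] at hy
      rw [((bj_d1 n hy.1).pow 2).deriv]
      have := hjp y hy.1 hy.2.le
      have hy0 := hy.1
      have e : ((2:ℕ):ℝ) * besselJ n y ^ (2-1) * (n / y * besselJ n y - besselJ (n + 1) y)
        = 2 * (besselJ n y * (n * besselJ n y - y * besselJ (n+1) y)) / y := by
        field_simp; norm_num; ring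
      rw [e]; positivity
  have hpos : ∀ y ∈ Ioc (0:ℝ) n, 0 < besselJ n y := by
    apply gt_of_ne_conn isPreconnected_Ioc (bj_cont n).continuousOn _ (x₀ := 1) ⟨one_pos, hn1⟩
      (bj_pos_one n 1 one_pos le_rfl)
    intro y hy h
    set z := min y 1 with hz
    have hz0 : 0 < z := lt_min hy.1 one_pos
    have := hm2 (a := z) (b := y) ⟨hz0.le, (min_le_left _ _).trans hy.2⟩ ⟨hy.1.le, hy.2⟩ (min_le_left _ _)
    have h3 := bj_pos_one n z hz0 (min_le_right _ _)
    simp [h] at this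
    rw [this] at h3
    exact lt_irrefl _ h3
  refine ⟨hpos x ⟨h0, h1⟩, ?_⟩
  have hm3 : StrictMonoOn (fun x => n * besselJ n x - x * besselJ (n+1) x) (Icc 0 n) := by
    apply strictMonoOn_of_deriv_pos (convex_Icc 0 _) hpc.continuousOn
    intro y hy
    rw [interior_Icc] at hy
    rw [(hpd y hy.1).deriv]
    have hy0 := hy.1
    have : (0:ℝ) < n^2 - y^2 := by nlinarith [hy.2]
    have := hpos y ⟨hy.1, hy.2.le⟩
    positivity
  have := hm3 (left_mem_Icc.2 (by linarith)) ⟨h0.le, h1⟩ h0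
  simpa [bj_at_zero n hn0] using this


/-- `θ` is an angle of `(u,v)` at `x`. -/
def AngleAt (u v θ : ℝ → ℝ) (x : ℝ) : Prop :=
  ∃ r : ℝ, 0 < r ∧ u x = r * Real.cos (θ x) ∧ v x = r * Real.sin (θ x)

lemma lift_exists (a : ℝ) (u v u' v' : ℝ → ℝ)
    (hu : ∀ x, a < x → HasDerivAt u (u' x) x) (hv : ∀ x, a < x → HasDerivAt v (v' x) x)
    (hu' : ContinuousOn u' (Ioi a)) (hv' : ContinuousOn v' (Ioi a))
    (hN : ∀ x, a < x → 0 < u x ^ 2 + v x ^ 2) (x₀ : ℝ) (hx₀ : a < x₀) (t₀ : ℝ) :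
    ∃ θ : ℝ → ℝ, |θ x₀ - t₀| ≤ π ∧ ∀ x, a < x →
      HasDerivAt θ ((u x * v' x - v x * u' x) / (u x ^ 2 + v x ^ 2)) x ∧ AngleAt u v θ x := by
  have huc : ContinuousOn u (Ioi a) := fun x hx => (hu x hx).continuousAt.continuousWithinAt
  have hvc : ContinuousOn v (Ioi a) := fun x hx => (hv x hx).continuousAt.continuousWithinAt
  set h : ℝ → ℝ := fun x => (u x * v' x - v x * u' x) / (u x ^ 2 + v x ^ 2) with hh
  have hc : ContinuousOn h (Ioi a) :=
    ((huc.mul hv').sub (hvc.mul hu')).div ((huc.pow 2).add (hvc.pow 2)) (fun x hx => (hN x hx).ne')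
  -- starting angle
  obtain ⟨θ₀, hθ₀, s, hs, hus, hvs⟩ : ∃ θ₀ : ℝ, |θ₀ - t₀| ≤ π ∧ ∃ s : ℝ, 0 < s ∧
      u x₀ = s * Real.cos θ₀ ∧ v x₀ = s * Real.sin θ₀ := by
    set z : ℂ := ⟨u x₀ * Real.cos t₀ + v x₀ * Real.sin t₀, v x₀ * Real.cos t₀ - u x₀ * Real.sin t₀⟩ with hz
    have hcs := Real.sin_sq_add_cos_sq t₀
    have hz0 : z ≠ 0 := by
      intro h0
      have h1 := congrArg Complex.re h0
      have h2 := congrArg Complex.im h0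
      simp [hz] at h1 h2
      have := hN x₀ hx₀
      nlinarith
    refine ⟨t₀ + Complex.arg z, ?_, ‖z‖, norm_pos_iff.2 hz0, ?_, ?_⟩
    · simp; exact Complex.abs_arg_le_pi z
    · have h1 : ‖z‖ * Real.cos z.arg = u x₀ * Real.cos t₀ + v x₀ * Real.sin t₀ := Complex.norm_mul_cos_arg z
      have h2 : ‖z‖ * Real.sin z.arg = v x₀ * Real.cos t₀ - u x₀ * Real.sin t₀ := Complex.norm_mul_sin_arg z
      rw [Real.cos_add]
      linear_combination (-Real.cos t₀) * h1 + (Real.sin t₀) * h2 - u x₀ * hcs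
    · have h1 : ‖z‖ * Real.cos z.arg = u x₀ * Real.cos t₀ + v x₀ * Real.sin t₀ := Complex.norm_mul_cos_arg z
      have h2 : ‖z‖ * Real.sin z.arg = v x₀ * Real.cos t₀ - u x₀ * Real.sin t₀ := Complex.norm_mul_sin_arg z
      rw [Real.sin_add]
      linear_combination (-Real.sin t₀) * h1 - (Real.cos t₀) * h2 - v x₀ * hcs
  set θ : ℝ → ℝ := fun x => θ₀ + ∫ y in x₀..x, h y with hθ
  have hθx₀ : θ x₀ = θ₀ := by simp [hθ]
  have hθd : ∀ x, a < x → HasDerivAt θ (h x) x := by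
    intro x hx
    have hsub : uIcc x₀ x ⊆ Ioi a := by
      intro y hy
      exact lt_of_lt_of_le (lt_min hx₀ hx) hy.1
    have := intervalIntegral.integral_hasDerivAt_right (f := h) (a := x₀) (b := x)
      ((hc.mono hsub).intervalIntegrable)
      (hc.stronglyMeasurableAtFilter isOpen_Ioi x hx)
      (hc.continuousAt (Ioi_mem_nhds hx))
    exact this.const_add θ₀
  refine ⟨θ, by rw [hθx₀]; exact hθ₀, fun x hx => ⟨hθd x hx, ?_⟩⟩
  -- conserved quantities
  have key : ∀ x, a < x →
      HasDerivAt (fun x => (u x * Real.cos (θ x) + v x * Real.sin (θ x)) / √(u x ^ 2 + v x ^ 2)) 0 x ∧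
      HasDerivAt (fun x => (v x * Real.cos (θ x) - u x * Real.sin (θ x)) / √(u x ^ 2 + v x ^ 2)) 0 x := by
    intro x hx
    have hNx := hN x hx
    have hsq : 0 < √(u x ^ 2 + v x ^ 2) := Real.sqrt_pos.2 hNx
    have hsq2 : √(u x ^ 2 + v x ^ 2) ^ 2 = u x ^ 2 + v x ^ 2 := Real.sq_sqrt hNx.le
    have d1 := (((hu x hx).fun_pow 2).fun_add ((hv x hx).fun_pow 2)).sqrt hNx.ne'
    have dc := (hθd x hx).cos
    have ds := (hθd x hx).sin
    have hhx : h x * (u x ^ 2 + v x ^ 2) = u x * v' x - v x * u' x := by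
      simp only [hh]; field_simp
    constructor
    · refine ((((hu x hx).fun_mul dc).fun_add ((hv x hx).fun_mul ds)).fun_div d1 hsq.ne').congr_deriv ?_
      rw [div_eq_zero_iff]; left
      field_simp
      rw [hsq2]
      simp
      linear_combination 2 * (v x * Real.cos (θ x) - u x * Real.sin (θ x)) * hhx
    · refine ((((hv x hx).fun_mul dc).fun_sub ((hu x hx).fun_mul ds)).fun_div d1 hsq.ne').congr_deriv ?_
      rw [div_eq_zero_iff]; left
      field_simp
      rw [hsq2]
      simp
      linear_combination -2 * (u x * Real.cos (θ x) + v x * Real.sin (θ x)) * hhx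
  have const : ∀ f : ℝ → ℝ, (∀ x, a < x → HasDerivAt f 0 x) → f x = f x₀ := by
    intro f hf
    exact isOpen_Ioi.is_const_of_deriv_eq_zero (isPreconnected_Ioi (a := a))
      (fun y hy => (hf y hy).differentiableAt.differentiableWithinAt)
      (fun y hy => (hf y hy).deriv) hx hx₀
  have c1 := const _ (fun y hy => (key y hy).1)
  have c2 := const _ (fun y hy => (key y hy).2)
  simp only [hθx₀] at c1 c2
  have hs2 : √(u x₀ ^ 2 + v x₀ ^ 2) = s := by
    rw [hus, hvs, show (s * Real.cos θ₀)^2 + (s * Real.sin θ₀)^2 = s^2 by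
      linear_combination s^2 * Real.sin_sq_add_cos_sq θ₀]
    exact Real.sqrt_sq hs.le
  have hsq : 0 < √(u x ^ 2 + v x ^ 2) := Real.sqrt_pos.2 (hN x hx)
  rw [hs2, div_eq_div_iff hsq.ne' hs.ne'] at c1 c2
  have e1 : u x * Real.cos (θ x) + v x * Real.sin (θ x) = √(u x ^ 2 + v x ^ 2) := by
    apply mul_right_cancel₀ hs.ne'
    rw [c1, hus, hvs]
    linear_combination √(u x ^ 2 + v x ^ 2) * s * Real.sin_sq_add_cos_sq θ₀
  have e2 : v x * Real.cos (θ x) - u x * Real.sin (θ x) = 0 := by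
    apply mul_right_cancel₀ hs.ne'
    rw [c2, hus, hvs]; ring
  refine ⟨√(u x ^ 2 + v x ^ 2), hsq, ?_, ?_⟩
  · linear_combination Real.cos (θ x) * e1 - Real.sin (θ x) * e2 - u x * Real.sin_sq_add_cos_sq (θ x)
  · linear_combination Real.sin (θ x) * e1 + Real.cos (θ x) * e2 - v x * Real.sin_sq_add_cos_sq (θ x)

lemma shear_cos {u v v2 α θ : ℝ → ℝ} {x l m : ℝ} (hm : 0 < m) (h1 : AngleAt u v α x)
    (h2 : AngleAt u v2 θ x) (h : v2 x = l * u x + m * v x) :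
    Real.cos (θ x - α x) ≠ -1 := by
  obtain ⟨r, hr, hu, hv⟩ := h1
  obtain ⟨s, hs, hu2, hv2⟩ := h2
  intro hc
  have hsin : Real.sin (θ x - α x) = 0 := by
    have := Real.sin_sq_add_cos_sq (θ x - α x)
    rw [hc] at this
    have : Real.sin (θ x - α x) ^ 2 = 0 := by linarith
    exact pow_eq_zero_iff (two_ne_zero) |>.1 this
  have ec : Real.cos (θ x) = - Real.cos (α x) := by
    have : θ x = α x + (θ x - α x) := by ring
    rw [this, Real.cos_add, hc, hsin]; ring
  have es : Real.sin (θ x) = - Real.sin (α x) := by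
    have : θ x = α x + (θ x - α x) := by ring
    rw [this, Real.sin_add, hc, hsin]; ring
  rw [ec] at hu2
  rw [es] at hv2
  have h0 : (r + s) * Real.cos (α x) = 0 := by linarith
  have hc0 : Real.cos (α x) = 0 := by
    rcases mul_eq_zero.1 h0 with h | h
    · linarith
    · exact h
  rw [hv2, hu, hv, hc0] at h
  have h00 : (s + m * r) * Real.sin (α x) = 0 := by linarith
  have hs0 : Real.sin (α x) = 0 := by
    rcases mul_eq_zero.1 h00 with h | h
    · nlinarith
    · exact h
  have := Real.sin_sq_add_cos_sq (α x)
  rw [hc0, hs0] at this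
  norm_num at this

lemma shear_lift (a : ℝ) (u v v2 α u' v2' : ℝ → ℝ) (l m : ℝ → ℝ)
    (hα : ContinuousOn α (Ioi a)) (hA : ∀ x, a < x → AngleAt u v α x)
    (hu : ∀ x, a < x → HasDerivAt u (u' x) x) (hv : ∀ x, a < x → HasDerivAt v2 (v2' x) x)
    (hu' : ContinuousOn u' (Ioi a)) (hv' : ContinuousOn v2' (Ioi a))
    (hm : ∀ x, a < x → 0 < m x) (h : ∀ x, a < x → v2 x = l x * u x + m x * v x) :
    ∃ θ : ℝ → ℝ, ∀ x, a < x →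
      HasDerivAt θ ((u x * v2' x - v2 x * u' x) / (u x ^ 2 + v2 x ^ 2)) x ∧ AngleAt u v2 θ x
        ∧ |θ x - α x| < π := by
  have hN : ∀ x, a < x → 0 < u x ^ 2 + v2 x ^ 2 := by
    intro x hx
    obtain ⟨r, hr, h1, h2⟩ := hA x hx
    by_cases hu0 : u x = 0
    · rw [h x hx, hu0, h2]
      have : Real.cos (α x) = 0 := by
        rw [hu0] at h1
        rcases mul_eq_zero.1 h1.symm with h | h
        · linarith
        · exact h
      have h3 := Real.sin_sq_add_cos_sq (α x)
      have h4 : Real.sin (α x) ≠ 0 := by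
        intro h5; rw [this, h5] at h3; norm_num at h3
      have := (hm x hx).ne'
      have h5 : m x * (r * Real.sin (α x)) ≠ 0 := by positivity
      have : 0 < (m x * (r * Real.sin (α x)))^2 := by positivity
      simpa using this
    · positivity
  obtain ⟨θ, h0, hθ⟩ := lift_exists a u v2 u' v2' hu hv hu' hv' hN (a+1) (by linarith) (α (a+1))
  refine ⟨θ, fun x hx => ⟨(hθ x hx).1, (hθ x hx).2, ?_⟩⟩
  have hne : ∀ x, a < x → Real.cos (θ x - α x) ≠ -1 := fun x hx =>
    shear_cos (hm x hx) (hA x hx) (hθ x hx).2 (h x hx)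
  have hcont : ContinuousOn (fun x => θ x - α x) (Ioi a) :=
    ContinuousOn.sub (fun y hy => (hθ y hy).1.continuousAt.continuousWithinAt) hα
  have hn1 : ∀ y ∈ Ioi a, θ y - α y ≠ π := fun y hy e => hne y hy (by rw [e]; simp)
  have hn2 : ∀ y ∈ Ioi a, θ y - α y ≠ -π := fun y hy e => hne y hy (by rw [e]; simp)
  have ha1 : a + 1 ∈ Ioi a := by simp
  rw [abs_le] at h0
  rw [abs_lt]
  exact ⟨gt_of_ne_conn isPreconnected_Ioi hcont hn2 ha1 (lt_of_le_of_ne h0.1 (hn2 _ ha1).symm) x hx,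
    lt_of_ne_conn isPreconnected_Ioi hcont hn1 ha1 (lt_of_le_of_ne h0.2 (hn1 _ ha1)) x hx⟩

lemma abs_lt_half {d : ℝ} (h : |d| < 3 * π / 2) (hc : 0 < Real.cos d) : |d| < π / 2 := by
  by_contra hcon
  push Not at hcon
  have := Real.cos_nonpos_of_pi_div_two_le_of_le hcon (by linarith)
  rw [Real.cos_abs] at this
  linarith

lemma abs_le_of_tan {d t : ℝ} (h : |d| < π / 2) (ht : Real.sin d = t * Real.cos d) : |d| ≤ |t| := by
  have hc : 0 < Real.cos d := Real.cos_pos_of_mem_Ioo (abs_lt.1 h)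
  have : Real.tan d = t := by rw [Real.tan_eq_sin_div_cos, ht]; field_simp
  rw [← this]
  rcases le_total 0 d with h0 | h0
  · rw [abs_of_nonneg h0] at *
    exact (Real.le_tan h0 h).trans (le_abs_self _)
  · rw [abs_of_nonpos h0] at *
    have := Real.le_tan (x := -d) (by linarith) h
    rw [Real.tan_neg] at this
    exact this.trans (neg_le_abs _)

lemma shear_close {u v v2 α θ : ℝ → ℝ} {x l m : ℝ} (h1 : AngleAt u v α x)
    (h2 : AngleAt u v2 θ x) (h : v2 x = l * u x + m * v x) (hd : |θ x - α x| < π)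
    (hs : |l| + |m - 1| ≤ 1/2) : |θ x - α x| ≤ 2 * (|l| + |m - 1|) := by
  obtain ⟨r, hr, hu, hv⟩ := h1
  obtain ⟨s, hs', hu2, hv2⟩ := h2
  set e := l * Real.cos (α x) + (m - 1) * Real.sin (α x) with he
  have hcs := Real.sin_sq_add_cos_sq (α x)
  have he1 : |e| ≤ |l| + |m - 1| := by
    rw [he]
    refine (abs_add_le _ _).trans ?_
    rw [abs_mul, abs_mul]
    have := Real.abs_cos_le_one (α x)
    have := Real.abs_sin_le_one (α x)
    have := abs_nonneg l
    have := abs_nonneg (m-1)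
    nlinarith
  have a1 : s * Real.cos (θ x) = r * Real.cos (α x) := by linarith
  have a2 : s * Real.sin (θ x) = r * Real.sin (α x) + r * e := by
    rw [← hv2, h, hu, hv, he]; ring
  have b1 : s * Real.cos (θ x - α x) = r * (1 + e * Real.sin (α x)) := by
    rw [Real.cos_sub]; linear_combination Real.cos (α x) * a1 + Real.sin (α x) * a2 + r * hcs
  have b2 : s * Real.sin (θ x - α x) = r * (e * Real.cos (α x)) := by
    rw [Real.sin_sub]; linear_combination Real.cos (α x) * a2 - Real.sin (α x) * a1
  have hes : |e * Real.sin (α x)| ≤ 1/2 := by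
    rw [abs_mul]
    have := Real.abs_sin_le_one (α x)
    have := abs_nonneg e
    nlinarith
  have hpos : 1/2 ≤ 1 + e * Real.sin (α x) := by linarith [(abs_le.1 hes).1]
  have hcpos : 0 < Real.cos (θ x - α x) := by
    have : 0 < s * Real.cos (θ x - α x) := by rw [b1]; positivity
    exact (pos_iff_pos_of_mul_pos this).1 hs'
  have hlt := abs_lt_half (by linarith [Real.pi_pos]) hcpos
  have := abs_le_of_tan hlt (t := e * Real.cos (α x) / (1 + e * Real.sin (α x))) (by
    have : 1 + e * Real.sin (α x) ≠ 0 := by linarith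
    field_simp
    apply mul_left_cancel₀ hs'.ne'
    linear_combination (1 + e * Real.sin (α x)) * b2 - e * Real.cos (α x) * b1)
  refine this.trans ?_
  rw [abs_div, div_le_iff₀ (by positivity), abs_of_pos (show 0 < 1 + e * Real.sin (α x) by linarith), abs_mul]
  have := Real.abs_cos_le_one (α x)
  have := abs_nonneg e
  nlinarith

lemma shear_tendsto (u v v2 α θ l m : ℝ → ℝ)
    (h : ∀ᶠ x in atTop, AngleAt u v α x ∧ AngleAt u v2 θ x ∧ v2 x = l x * u x + m x * v x
      ∧ |θ x - α x| < π)
    (hl : Tendsto l atTop (𝓝 0)) (hm : Tendsto m atTop (𝓝 1)) :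
    Tendsto (fun x => θ x - α x) atTop (𝓝 0) := by
  have h0 : Tendsto (fun x => |l x| + |m x - 1|) atTop (𝓝 0) := by
    simpa using hl.abs.add (hm.sub_const 1).abs
  have h1 : Tendsto (fun x => 2 * (|l x| + |m x - 1|)) atTop (𝓝 0) := by
    simpa using h0.const_mul 2
  have h2 : ∀ᶠ x in atTop, |l x| + |m x - 1| ≤ 1/2 := h0.eventually_le_const (by norm_num)
  apply squeeze_zero_norm' _ h1
  filter_upwards [h, h2] with x hx hx2
  exact shear_close hx.1 hx.2.1 hx.2.2.1 hx.2.2.2 hx2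


/-- Fresnel-type integral. -/
noncomputable def fr (z : ℝ) : ℂ := ∫ u in (0:ℝ)..z, Complex.exp (-(Complex.I * (u:ℂ)^2))

lemma fr_deriv (z : ℝ) : HasDerivAt fr (Complex.exp (-(Complex.I * (z:ℂ)^2))) z := by
  have hc : Continuous fun u : ℝ => Complex.exp (-(Complex.I * (u:ℂ)^2)) := by fun_prop
  exact intervalIntegral.integral_hasDerivAt_right (hc.intervalIntegrable _ _)
    (hc.stronglyMeasurableAtFilter _ _) hc.continuousAt

lemma fr_cont : Continuous fr := continuous_iff_continuousAt.2 fun z => (fr_deriv z).continuousAt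

lemma fr_comp_deriv (z t : ℝ) : HasDerivAt (fun t : ℝ => fr (z * t))
    (z * Complex.exp (-(Complex.I * (z:ℂ)^2 * (t:ℂ)^2))) t := by
  have h1 : HasDerivAt (fun t : ℝ => z * t) z t := by simpa using (hasDerivAt_id t).const_mul z
  have := (fr_deriv (z * t)).scomp t h1
  refine this.congr_deriv ?_
  simp
  left
  congr 1; ring

lemma fr_eq (z : ℝ) : fr z = z * ∫ t in (0:ℝ)..1, Complex.exp (-(Complex.I * (z:ℂ)^2 * (t:ℂ)^2)) := by
  rw [← intervalIntegral.integral_const_mul]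
  rw [intervalIntegral.integral_eq_sub_of_hasDerivAt (f := fun t : ℝ => fr (z * t))]
  · simp [fr]
  · intro t _; exact fr_comp_deriv z t
  · exact (by fun_prop : Continuous _).intervalIntegrable _ _

noncomputable def gg (z : ℝ) : ℂ :=
  ∫ t in (0:ℝ)..1, Complex.exp (-(Complex.I * (z:ℂ)^2 * (1 + (t:ℂ)^2))) * ((1 / (1 + t^2) : ℝ) : ℂ)

lemma one_add_sq_ne (t : ℝ) : (1 + t^2 : ℝ) ≠ 0 := by positivity

lemma gg_deriv (z : ℝ) : HasDerivAt gg (∫ t in (0:ℝ)..1, -(2 * Complex.I * z) *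
    Complex.exp (-(Complex.I * (z:ℂ)^2 * (1 + (t:ℂ)^2)))) z := by
  apply hasDerivAt_param (fun z t => Complex.exp (-(Complex.I * (z:ℂ)^2 * (1 + (t:ℂ)^2))) * ((1 / (1 + t^2) : ℝ) : ℂ))
    (fun z t => -(2 * Complex.I * z) * Complex.exp (-(Complex.I * (z:ℂ)^2 * (1 + (t:ℂ)^2))))
  · refine Continuous.mul (by fun_prop) (Complex.continuous_ofReal.comp ?_)
    exact continuous_const.div (by fun_prop) (fun p => one_add_sq_ne _)
  · fun_prop
  · intro x t
    have h1 : HasDerivAt (fun x : ℝ => (x:ℂ)) 1 x := Complex.ofRealCLM.hasDerivAt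
    have h2 := ((((h1.fun_pow 2).const_mul Complex.I).mul_const (1 + (t:ℂ)^2)).fun_neg.cexp).mul_const
      (((1 / (1 + t^2) : ℝ) : ℂ))
    refine h2.congr_deriv ?_
    have : (1 + (t:ℂ)^2) ≠ 0 := by
      have := one_add_sq_ne t
      exact_mod_cast this
    push_cast
    field_simp

lemma gg_zero : gg 0 = ((π / 4 : ℝ) : ℂ) := by
  unfold gg
  simp only [Complex.ofReal_zero, ne_eq, OfNat.ofNat_ne_zero, not_false_eq_true, zero_pow, mul_zero, zero_mul,
    neg_zero, Complex.exp_zero, one_mul]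
  rw [intervalIntegral.integral_ofReal]
  have := integral_one_div_one_add_sq (a := 0) (b := 1)
  rw [this]; simp

lemma fr_sq (z : ℝ) : fr z ^ 2 = Complex.I * (gg z - ((π / 4 : ℝ) : ℂ)) := by
  have hd : ∀ z, HasDerivAt (fun z => fr z ^ 2 - Complex.I * gg z) 0 z := by
    intro z
    refine (((fr_deriv z).fun_pow 2).fun_sub ((gg_deriv z).const_mul Complex.I)).congr_deriv ?_
    rw [intervalIntegral.integral_const_mul]
    have e : ∀ t : ℝ, Complex.exp (-(Complex.I * (z:ℂ)^2 * (1 + (t:ℂ)^2)))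
        = Complex.exp (-(Complex.I * (z:ℂ)^2)) * Complex.exp (-(Complex.I * (z:ℂ)^2 * (t:ℂ)^2)) := by
      intro t; rw [← Complex.exp_add]; congr 1; ring
    simp only [e]
    rw [intervalIntegral.integral_const_mul, fr_eq z]
    have := Complex.I_sq
    push_cast
    ring_nf
    rw [this]; ring
  have := is_const_of_deriv_eq_zero (f := fun z => fr z ^ 2 - Complex.I * gg z)
    (fun z => (hd z).differentiableAt) (fun z => (hd z).deriv) z 0
  have h0 : fr 0 = 0 := by simp [fr]
  simp only [h0, gg_zero] at this
  linear_combination this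

lemma norm_e (a : ℝ) : ‖Complex.exp (-(Complex.I * a))‖ = 1 := by
  rw [show -(Complex.I * (a:ℂ)) = ((-a : ℝ):ℂ) * Complex.I by push_cast; ring]
  exact Complex.norm_exp_ofReal_mul_I _

lemma gg_bound (z : ℝ) : ‖gg z‖ ≤ 1 := by
  unfold gg
  have := intervalIntegral.norm_integral_le_of_norm_le_const (a := 0) (b := 1) (C := 1)
    (f := fun t : ℝ => Complex.exp (-(Complex.I * (z:ℂ)^2 * (1 + (t:ℂ)^2))) * ((1 / (1 + t^2) : ℝ) : ℂ)) ?_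
  · simpa using this
  · intro t _
    rw [norm_mul]
    have := norm_e (z^2 * (1+t^2))
    push_cast at this
    rw [mul_assoc, this, one_mul, Complex.norm_real, Real.norm_eq_abs, abs_of_pos (by positivity)]
    rw [div_le_one (by positivity)]
    nlinarith [sq_nonneg t]

lemma fr_bound (z : ℝ) : ‖fr z‖ ≤ 2 := by
  have h := congrArg norm (fr_sq z)
  rw [norm_pow, norm_mul, Complex.norm_I, one_mul] at h
  have h1 := norm_sub_le (gg z) ((π / 4 : ℝ) : ℂ)
  have h2 := gg_bound z
  rw [Complex.norm_real, Real.norm_eq_abs, abs_of_pos (by positivity)] at h1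
  have := Real.pi_le_four
  have := norm_nonneg (fr z)
  nlinarith

lemma gg_decay (z : ℝ) (hz : 0 < z) : ‖gg z‖ ≤ 5 / z := by
  have hz' : (z:ℂ) ≠ 0 := by exact_mod_cast hz.ne'
  set h : ℝ → ℂ := fun t => ((1 / (1 + t^2) : ℝ) : ℂ) with hh
  set h' : ℝ → ℂ := fun t => ((-(2*t) / (1 + t^2)^2 : ℝ) : ℂ) with hh'
  have hhd : ∀ t, HasDerivAt h (h' t) t := by
    intro t
    have h1 : HasDerivAt (fun t : ℝ => 1 / (1 + t^2)) (-(2*t) / (1 + t^2)^2) t := by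
      have := ((hasDerivAt_pow 2 t).const_add 1).fun_inv (one_add_sq_ne t)
      simp only [one_div]
      refine this.congr_deriv ?_
      norm_num
    exact h1.ofReal_comp
  have hc' : Continuous h' := Complex.continuous_ofReal.comp
    ((by fun_prop : Continuous fun t : ℝ => -(2*t)).div (by fun_prop) (fun t => pow_ne_zero 2 (one_add_sq_ne t)))
  have hbp := intervalIntegral.integral_mul_deriv_eq_deriv_mul (a := 0) (b := 1) (u := h) (u' := h')
    (v := fun t : ℝ => fr (z * t)) (v' := fun t : ℝ => z * Complex.exp (-(Complex.I * (z:ℂ)^2 * (t:ℂ)^2)))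
    (fun t _ => hhd t) (fun t _ => fr_comp_deriv z t) (hc'.intervalIntegrable _ _)
    ((by fun_prop : Continuous _).intervalIntegrable _ _)
  have e1 : z * gg z = Complex.exp (-(Complex.I * (z:ℂ)^2)) *
      ∫ t in (0:ℝ)..1, h t * (z * Complex.exp (-(Complex.I * (z:ℂ)^2 * (t:ℂ)^2))) := by
    unfold gg
    rw [← intervalIntegral.integral_const_mul, ← intervalIntegral.integral_const_mul]
    congr 1; ext t
    have e : Complex.exp (-(Complex.I * (z:ℂ)^2 * (1 + (t:ℂ)^2)))
        = Complex.exp (-(Complex.I * (z:ℂ)^2)) * Complex.exp (-(Complex.I * (z:ℂ)^2 * (t:ℂ)^2)) := by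
      rw [← Complex.exp_add]; congr 1; ring
    rw [e]; ring
  rw [hbp] at e1
  have hint : ‖∫ t in (0:ℝ)..1, h' t * fr (z * t)‖ ≤ 4 * |1 - 0| := by
    apply intervalIntegral.norm_integral_le_of_norm_le_const
    intro t ht
    rw [uIoc_of_le zero_le_one] at ht
    rw [norm_mul]
    have h1 : ‖h' t‖ ≤ 2 := by
      simp only [hh']
      rw [Complex.norm_real, Real.norm_eq_abs, abs_div, abs_neg, abs_of_nonneg (by linarith [ht.1] : 0 ≤ 2*t),
        abs_of_pos (by positivity), div_le_iff₀ (by positivity)]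
      nlinarith [ht.1, ht.2, sq_nonneg t, sq_nonneg (t^2)]
    have := fr_bound (z * t)
    have := norm_nonneg (h' t)
    have := norm_nonneg (fr (z*t))
    nlinarith
  have h0 : fr (z * 0) = 0 := by simp [fr]
  have h1 : ‖h 1 * fr (z * 1)‖ ≤ 1 := by
    rw [norm_mul]
    have := fr_bound (z * 1)
    have : ‖h 1‖ = 1/2 := by simp only [hh]; rw [Complex.norm_real]; norm_num
    rw [this]; linarith
  have h2 := congrArg norm e1
  have hne : ‖Complex.exp (-(Complex.I * (z:ℂ)^2))‖ = 1 := by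
    have := norm_e (z^2); push_cast at this; exact this
  rw [norm_mul, norm_mul, hne, Complex.norm_real, Real.norm_eq_abs, abs_of_pos hz, one_mul, h0, mul_zero, sub_zero] at h2
  have h3 := norm_sub_le (h 1 * fr (z * 1)) (∫ t in (0:ℝ)..1, h' t * fr (z * t))
  rw [le_div_iff₀ hz, mul_comm, h2]
  norm_num at hint
  linarith

lemma fr_sq_tendsto : Tendsto (fun z => fr z ^ 2) atTop (𝓝 (-(Complex.I * ((π / 4 : ℝ) : ℂ)))) := by
  have h : Tendsto gg atTop (𝓝 0) := by
    apply squeeze_zero_norm' _ (tendsto_const_nhds.div_atTop tendsto_id : Tendsto (fun z : ℝ => 5 / z) atTop (𝓝 0))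
    filter_upwards [eventually_gt_atTop 0] with z hz
    exact gg_decay z hz
  simp only [fr_sq]
  have := (h.sub_const ((π / 4 : ℝ) : ℂ)).const_mul Complex.I
  simpa using this

lemma sqrt_tendsto (f : ℝ → ℂ) (hf : Continuous f) (d : ℂ) (hd : d ≠ 0)
    (h : Tendsto (fun z => f z ^ 2) atTop (𝓝 d)) : ∃ c : ℂ, c ^ 2 = d ∧ Tendsto f atTop (𝓝 c) := by
  obtain ⟨c, hc⟩ := IsAlgClosed.exists_pow_nat_eq d (n := 2) (by norm_num)
  have hc0 : c ≠ 0 := by rintro rfl; simp at hc; exact hd hc.symm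
  set g : ℝ → ℂ := fun z => f z / c with hg
  have hgc : Continuous g := hf.div_const c
  have hg2 : Tendsto (fun z => g z ^ 2 - 1) atTop (𝓝 0) := by
    have := (h.div_const d).sub_const 1
    rw [div_self hd, sub_self] at this
    refine this.congr fun z => ?_
    simp only [hg]; rw [div_pow, hc]
  have hn : Tendsto (fun z => ‖g z ^ 2 - 1‖) atTop (𝓝 0) := by simpa using hg2.norm
  obtain ⟨Z, hZ⟩ := eventually_atTop.1 (hn.eventually_lt_const (one_pos))
  have hre : ∀ z ∈ Ici Z, (g z).re ≠ 0 := by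
    intro z hz h0
    have h1 := hZ z hz
    have h2 := (Complex.abs_re_le_norm (g z ^ 2 - 1)).trans_lt h1
    rw [pow_two] at h2
    simp [h0] at h2
    rw [abs_lt] at h2
    nlinarith [mul_self_nonneg (g z).im]
  have hrc : ContinuousOn (fun z => (g z).re) (Ici Z) := (Complex.continuous_re.comp hgc).continuousOn
  have fin : ∀ s : ℂ, s ^ 2 = 1 → (∀ z ∈ Ici Z, 1 ≤ ‖g z + s‖) → Tendsto f atTop (𝓝 (s * c)) := by
    intro s hs hb
    have : Tendsto (fun z => g z - s) atTop (𝓝 0) := by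
      apply squeeze_zero_norm' _ hn
      filter_upwards [eventually_ge_atTop Z] with z hz
      have e : g z ^ 2 - 1 = (g z - s) * (g z + s) := by rw [← hs]; ring
      rw [e, norm_mul]
      have := hb z hz
      have := norm_nonneg (g z - s)
      nlinarith
    have h2 := (this.add_const s).mul_const c
    rw [zero_add] at h2
    refine h2.congr fun z => ?_
    simp only [hg]; field_simp; ring
  rcases lt_or_gt_of_ne (hre Z (mem_Ici.2 le_rfl)) with h0 | h0
  · have hall := lt_of_ne_conn isPreconnected_Ici hrc hre (mem_Ici.2 le_rfl) h0
    refine ⟨(-1) * c, by rw [← hc]; ring, fin (-1) (by norm_num) ?_⟩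
    intro z hz
    have h1 := hall z hz
    have h2 := Complex.abs_re_le_norm (g z + -1)
    simp at h2
    rw [abs_of_neg (by linarith)] at h2
    linarith
  · have hall := gt_of_ne_conn isPreconnected_Ici hrc hre (mem_Ici.2 le_rfl) h0
    refine ⟨1 * c, by rw [← hc]; ring, fin 1 (by norm_num) ?_⟩
    intro z hz
    have h1 := hall z hz
    have h2 := Complex.abs_re_le_norm (g z + 1)
    simp at h2
    rw [abs_of_pos (by linarith)] at h2
    linarith

lemma fr_tendsto : ∃ c : ℂ, c ^ 2 = -(Complex.I * ((π / 4 : ℝ) : ℂ)) ∧ Tendsto fr atTop (𝓝 c) := by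
  apply sqrt_tendsto fr fr_cont _ _ fr_sq_tendsto
  simp

lemma bj_byparts (y : ℝ) :
    y * ∫ τ in (0:ℝ)..(π/2), (Real.cos τ : ℂ)^2 * Complex.exp (-(Complex.I * (y:ℂ)^2 * (Real.sin τ:ℂ)^2))
      = ∫ τ in (0:ℝ)..(π/2), (Real.sin τ : ℂ) * fr (y * Real.sin τ) := by
  have hbp := intervalIntegral.integral_mul_deriv_eq_deriv_mul (a := 0) (b := π/2)
    (u := fun τ : ℝ => ((Real.cos τ : ℝ) : ℂ)) (u' := fun τ : ℝ => ((-Real.sin τ : ℝ) : ℂ))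
    (v := fun t : ℝ => fr (y * Real.sin t))
    (v' := fun t : ℝ => (Real.cos t) • (y * Complex.exp (-(Complex.I * (y:ℂ)^2 * ((Real.sin t : ℝ):ℂ)^2))))
    (fun t _ => (Real.hasDerivAt_cos t).ofReal_comp)
    (fun t _ => (fr_comp_deriv y (Real.sin t)).scomp t (Real.hasDerivAt_sin t))
    ((by fun_prop : Continuous _).intervalIntegrable _ _)
    ((by fun_prop : Continuous _).intervalIntegrable _ _)
  rw [← intervalIntegral.integral_const_mul]
  have h0 : fr 0 = 0 := by simp [fr]
  rw [Real.cos_pi_div_two, Real.sin_zero, mul_zero, h0, Complex.ofReal_zero, zero_mul, mul_zero, sub_zero, zero_sub,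
    ← intervalIntegral.integral_neg] at hbp
  calc _ = ∫ (x : ℝ) in (0:ℝ)..π / 2, ((Real.cos x : ℝ):ℂ) * Real.cos x • (↑y * Complex.exp (-(Complex.I * ↑y ^ 2 * ((Real.sin x : ℝ):ℂ) ^ 2))) := by
        congr 1; ext t; rw [Complex.real_smul]; ring
    _ = _ := by
        rw [hbp]; congr 1; ext t; push_cast; ring

lemma dct_lim (c : ℂ) (hc : Tendsto fr atTop (𝓝 c)) :
    Tendsto (fun y : ℝ => ∫ τ in (0:ℝ)..(π/2), (Real.sin τ : ℂ) * fr (y * Real.sin τ)) atTop (𝓝 c) := by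
  have h : ∫ τ in (0:ℝ)..(π/2), (Real.sin τ : ℂ) * c = c := by
    rw [intervalIntegral.integral_mul_const, intervalIntegral.integral_ofReal, integral_sin]; simp
  have key : Tendsto (fun y : ℝ => ∫ τ in (0:ℝ)..(π/2), (Real.sin τ : ℂ) * fr (y * Real.sin τ)) atTop
      (𝓝 (∫ τ in (0:ℝ)..(π/2), (Real.sin τ : ℂ) * c)) := by
    apply intervalIntegral.tendsto_integral_filter_of_dominated_convergence (fun _ => 2)
    · refine Eventually.of_forall fun y => ?_
      have := fr_cont
      exact (by fun_prop : Continuous _).aestronglyMeasurable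
    · refine Eventually.of_forall fun y => Eventually.of_forall fun t _ => ?_
      rw [norm_mul, Complex.norm_real, Real.norm_eq_abs]
      have := fr_bound (y * Real.sin t)
      have := Real.abs_sin_le_one t
      have := abs_nonneg (Real.sin t)
      nlinarith [norm_nonneg (fr (y * Real.sin t))]
    · exact intervalIntegrable_const
    · refine Eventually.of_forall fun t ht => ?_
      rw [uIoc_of_le (by positivity)] at ht
      have hs : 0 < Real.sin t := Real.sin_pos_of_pos_of_lt_pi ht.1 (by linarith [ht.2, Real.pi_pos])
      exact (hc.comp (tendsto_id.atTop_mul_const hs)).const_mul _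
  rwa [h] at key

lemma shift_half (f : ℝ → ℝ) (hf : Function.Periodic f π) :
    ∫ t in (0:ℝ)..π, f t = ∫ t in (0:ℝ)..π, f (t + π/2) := by
  rw [intervalIntegral.integral_comp_add_right]
  have := hf.intervalIntegral_add_eq 0 (π/2)
  rw [zero_add] at this ⊢
  rw [this]; congr 1; ring

lemma flip_zero (f : ℝ → ℝ) (hf : ∀ t, f (π - t) = - f t) : ∫ t in (0:ℝ)..π, f t = 0 := by
  have := intervalIntegral.integral_comp_sub_left f (a := 0) (b := π) π
  simp only [hf, sub_self, sub_zero, intervalIntegral.integral_neg] at this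
  linarith

lemma J0_eq (x : ℝ) : π * besselJ 0 x = ∫ t in (0:ℝ)..π, (1 + Real.cos t) * Real.cos (x * Real.cos t) := by
  have h0 : ∫ t in (0:ℝ)..π, Real.cos t * Real.cos (x * Real.cos t) = 0 := by
    apply flip_zero; intro t; simp
  have h1 := shift_half (fun t => Real.cos (x * Real.sin t)) (fun t => by simp [Real.sin_add_pi])
  simp only [Real.sin_add_pi_div_two] at h1
  simp only [add_mul, one_mul]
  rw [intervalIntegral.integral_add ((by fun_prop : Continuous _).intervalIntegrable _ _)
    ((by fun_prop : Continuous _).intervalIntegrable _ _), h0, ← h1]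
  unfold besselJ
  have := Real.pi_ne_zero
  field_simp
  simp

lemma J1_eq (x : ℝ) : π * besselJ 1 x = ∫ t in (0:ℝ)..π, (1 + Real.cos t) * Real.sin (x * Real.cos t) := by
  have h0 : ∫ t in (0:ℝ)..π, Real.sin (x * Real.cos t) = 0 := by
    apply flip_zero; intro t; simp
  have h00 : ∫ t in (0:ℝ)..π, Real.cos (x * Real.sin t) * Real.cos t = 0 := by
    apply flip_zero; intro t; simp
  have h1 := shift_half (fun t => Real.sin (x * Real.sin t) * Real.sin t) (fun t => by simp [Real.sin_add_pi])
  simp only [Real.sin_add_pi_div_two] at h1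
  simp only [add_mul, one_mul]
  rw [intervalIntegral.integral_add ((by fun_prop : Continuous _).intervalIntegrable _ _)
    ((by fun_prop : Continuous _).intervalIntegrable _ _), h0]
  simp only [mul_comm (Real.cos _)]
  rw [← h1]
  unfold besselJ
  have := Real.pi_ne_zero
  field_simp
  simp only [Nat.cast_one, one_mul, Real.cos_sub, zero_add]
  rw [intervalIntegral.integral_add ((by fun_prop : Continuous _).intervalIntegrable _ _)
    ((by fun_prop : Continuous _).intervalIntegrable _ _), h00, zero_add]
  congr 1; ext t; ring

lemma J01_eq (x : ℝ) (hx : 0 < x) :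
    Complex.exp (-(Complex.I * x)) * ((besselJ 0 x : ℂ) + Complex.I * besselJ 1 x)
    = (4 / π : ℝ) * ∫ τ in (0:ℝ)..(π/2), (Real.cos τ : ℂ)^2 * Complex.exp (-(Complex.I * ((√(2*x) : ℝ):ℂ)^2 * (Real.sin τ:ℂ)^2)) := by
  have hs : (((√(2*x) : ℝ):ℂ))^2 = 2 * x := by
    rw [← Complex.ofReal_pow, Real.sq_sqrt (by linarith)]; push_cast; rfl
  have h1 : (π:ℂ) * ((besselJ 0 x : ℂ) + Complex.I * besselJ 1 x)
      = ∫ t in (0:ℝ)..π, ((1 + Real.cos t : ℝ):ℂ) * Complex.exp (((x * Real.cos t : ℝ):ℂ) * Complex.I) := by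
    have e : ∀ t : ℝ, ((1 + Real.cos t : ℝ):ℂ) * Complex.exp (((x * Real.cos t : ℝ):ℂ) * Complex.I)
      = (((1 + Real.cos t) * Real.cos (x * Real.cos t) : ℝ) : ℂ)
        + Complex.I * (((1 + Real.cos t) * Real.sin (x * Real.cos t) : ℝ) : ℂ) := by
      intro t
      rw [Complex.exp_mul_I, ← Complex.ofReal_cos, ← Complex.ofReal_sin]; push_cast; ring
    simp only [e]
    rw [intervalIntegral.integral_add ((by fun_prop : Continuous _).intervalIntegrable _ _)
      ((by fun_prop : Continuous _).intervalIntegrable _ _), intervalIntegral.integral_const_mul,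
      intervalIntegral.integral_ofReal, intervalIntegral.integral_ofReal, ← J0_eq, ← J1_eq]
    push_cast; ring
  have h2 : ∫ t in (0:ℝ)..π, ((1 + Real.cos t : ℝ):ℂ) * Complex.exp (((x * Real.cos t : ℝ):ℂ) * Complex.I)
     = 2 * ∫ τ in (0:ℝ)..(π/2), ((1 + Real.cos (2*τ) : ℝ):ℂ) * Complex.exp (((x * Real.cos (2*τ) : ℝ):ℂ) * Complex.I) := by
    have := intervalIntegral.integral_comp_mul_left (a := 0) (b := π/2) (c := 2)
      (fun t : ℝ => ((1 + Real.cos t : ℝ):ℂ) * Complex.exp (((x * Real.cos t : ℝ):ℂ) * Complex.I)) two_ne_zero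
    rw [this, mul_zero, show 2 * (π/2) = π by ring, Complex.real_smul]
    push_cast; ring
  have h3 : ∀ τ : ℝ, ((1 + Real.cos (2*τ) : ℝ):ℂ) * Complex.exp (((x * Real.cos (2*τ) : ℝ):ℂ) * Complex.I)
     = (2 * Complex.exp (Complex.I * x)) * ((Real.cos τ : ℂ)^2 * Complex.exp (-(Complex.I * ((√(2*x) : ℝ):ℂ)^2 * (Real.sin τ:ℂ)^2))) := by
    intro τ
    have ec : Real.cos (2*τ) = 1 - 2 * Real.sin τ ^2 := by
      rw [Real.cos_two_mul]; linarith [Real.sin_sq_add_cos_sq τ]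
    have e1 : (1 + Real.cos (2*τ) : ℝ) = 2 * Real.cos τ ^2 := by rw [Real.cos_two_mul]; ring
    rw [e1, hs, ec]
    have : Complex.exp (((x * (1 - 2 * Real.sin τ ^2) : ℝ):ℂ) * Complex.I)
      = Complex.exp (Complex.I * x) * Complex.exp (-(Complex.I * (2 * x) * (Real.sin τ:ℂ)^2)) := by
      rw [← Complex.exp_add]; congr 1; push_cast; ring
    rw [this]; push_cast; ring
  rw [h2] at h1
  simp only [h3] at h1
  rw [intervalIntegral.integral_const_mul] at h1
  have hpi : (π:ℂ) ≠ 0 := by exact_mod_cast Real.pi_ne_zero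
  have hee : Complex.exp (-(Complex.I * x)) * Complex.exp (Complex.I * x) = 1 := by
    rw [← Complex.exp_add]; simp
  apply mul_left_cancel₀ hpi
  rw [mul_left_comm, h1]
  push_cast
  field_simp
  push_cast at *
  linear_combination (4 * ∫ τ in (0:ℝ)..(π/2), (Complex.cos τ : ℂ)^2 * Complex.exp (-(Complex.I * ((√(2*x) : ℝ):ℂ)^2 * (Complex.sin τ:ℂ)^2))) * hee

lemma J01_lim : Tendsto (fun x : ℝ => ((√(2*x) : ℝ):ℂ) ^ 2 * (Complex.exp (-(Complex.I * x)) *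
    ((besselJ 0 x : ℂ) + Complex.I * besselJ 1 x)) ^ 2) atTop (𝓝 (-(Complex.I * ((4 / π : ℝ) : ℂ)))) := by
  obtain ⟨c, hc2, hc⟩ := fr_tendsto
  have hy : Tendsto (fun x : ℝ => √(2*x)) atTop atTop :=
    Real.tendsto_sqrt_atTop.comp (tendsto_id.const_mul_atTop (by norm_num : (0:ℝ) < 2))
  have h := (((dct_lim c hc).comp hy).const_mul (((4 / π : ℝ) : ℂ))).pow 2
  have e : (((4 / π : ℝ) : ℂ) * c)^2 = -(Complex.I * ((4 / π : ℝ) : ℂ)) := by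
    rw [mul_pow, hc2]
    have hpi : (π:ℂ) ≠ 0 := by exact_mod_cast Real.pi_ne_zero
    push_cast; field_simp
  rw [e] at h
  refine h.congr' ?_
  filter_upwards [eventually_gt_atTop 0] with x hx
  rw [J01_eq x hx]
  simp only [Function.comp]
  rw [← bj_byparts]
  ring


lemma quadrant {t : ℝ} (h1 : -(3*π/2) < t) (h2 : t ≤ π) (hc : 0 < Real.cos t) (hs : 0 < Real.sin t) :
    0 < t ∧ t < π/2 := by
  have hp := Real.pi_pos
  have := abs_lt_half (d := t) (abs_lt.2 ⟨by linarith, by linarith⟩) hc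
  rw [abs_lt] at this
  refine ⟨?_, this.2⟩
  by_contra h
  push Not at h
  have := Real.sin_nonpos_of_nonpos_of_neg_pi_le h (by linarith)
  linarith

lemma gamma_lim (γ : ℝ → ℝ) (hb : ∀ᶠ x in atTop, |γ x| ≤ 4 + π/2)
    (hc : Tendsto (fun x => Real.cos (γ x)) atTop (𝓝 1)) : Tendsto γ atTop (𝓝 0) := by
  have h1 : Tendsto (fun x => Real.arccos (Real.cos (γ x))) atTop (𝓝 0) := by
    have := (Real.continuous_arccos.tendsto 1).comp hc
    rw [Real.arccos_one] at this; exact this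
  have h2 : ∀ᶠ x in atTop, Real.arccos (Real.cos (γ x)) < 1/2 := h1.eventually_lt_const (by norm_num)
  apply squeeze_zero_norm' _ h1
  filter_upwards [hb, h2] with x hx hx2
  rw [← Real.cos_abs] at hx2 ⊢
  have hp := Real.pi_gt_d2
  rcases le_or_gt |γ x| π with h | h
  · rw [Real.arccos_cos (abs_nonneg _) h]; rfl
  · rw [← Real.cos_two_pi_sub, Real.arccos_cos (by linarith) (by linarith)] at hx2
    linarith

lemma J01_sin (α : ℝ → ℝ) (hA : ∀ x, 0 < x → AngleAt (besselJ 0) (besselJ 1) α x) :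
    Tendsto (fun x => Real.sin (2 * (α x - x))) atTop (𝓝 (-1)) := by
  set R : ℝ → ℝ := fun x => 2 * x * (besselJ 0 x ^ 2 + besselJ 1 x ^ 2) with hR
  have key : ∀ᶠ x : ℝ in atTop, ((√(2*x) : ℝ):ℂ) ^ 2 * (Complex.exp (-(Complex.I * x)) *
    ((besselJ 0 x : ℂ) + Complex.I * besselJ 1 x)) ^ 2 = (R x : ℂ) * Complex.exp (((2 * (α x - x) : ℝ) : ℂ) * Complex.I) := by
    filter_upwards [eventually_gt_atTop 0] with x hx
    obtain ⟨r, hr, hu, hv⟩ := hA x hx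
    have h1 : ((besselJ 0 x : ℂ) + Complex.I * besselJ 1 x) = r * Complex.exp ((α x : ℂ) * Complex.I) := by
      rw [hu, hv, Complex.exp_mul_I]; push_cast; ring
    have h2 : R x = 2 * x * r^2 := by
      simp only [hR]; rw [hu, hv]; linear_combination 2 * x * r^2 * Real.sin_sq_add_cos_sq (α x)
    rw [h1, h2]
    have h3 : (((√(2*x) : ℝ):ℂ))^2 = 2 * x := by
      rw [← Complex.ofReal_pow, Real.sq_sqrt (by linarith)]; push_cast; rfl
    have h4 : Complex.exp (((2 * (α x - x) : ℝ) : ℂ) * Complex.I) =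
       (Complex.exp (-(Complex.I * x)) * Complex.exp ((α x : ℂ) * Complex.I))^2 := by
      rw [← Complex.exp_add, sq, ← Complex.exp_add]; congr 1; push_cast; ring
    rw [h3, h4]; push_cast; ring
  have hz := J01_lim.congr' key
  have hn := hz.norm
  have hi := (Complex.continuous_im.tendsto _).comp hz
  have hR1 : Tendsto R atTop (𝓝 (4/π)) := by
    have e : ‖-(Complex.I * ((4 / π : ℝ) : ℂ))‖ = 4/π := by
      rw [norm_neg, norm_mul, Complex.norm_I, one_mul, Complex.norm_real, Real.norm_of_nonneg (by positivity)]
    rw [e] at hn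
    refine hn.congr' ?_
    filter_upwards [eventually_gt_atTop 0] with x hx
    rw [norm_mul, Complex.norm_exp_ofReal_mul_I, mul_one, Complex.norm_real, Real.norm_of_nonneg]
    simp only [hR]; positivity
  have hI1 : Tendsto (fun x => R x * Real.sin (2 * (α x - x))) atTop (𝓝 (-(4/π))) := by
    have e : (-(Complex.I * ((4 / π : ℝ) : ℂ))).im = -(4/π) := by
      rw [Complex.neg_im, Complex.I_mul_im, Complex.ofReal_re]
    rw [e] at hi
    refine hi.congr fun x => ?_
    simp only [Function.comp]
    rw [Complex.im_ofReal_mul]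
    rw [Complex.exp_ofReal_mul_I_im]
  have h := hI1.div hR1 (by positivity)
  have e : -(4/π)/(4/π) = -1 := by rw [neg_div, div_self (by positivity)]
  rw [e] at h
  refine h.congr' ?_
  filter_upwards [eventually_gt_atTop 0] with x hx
  have : R x ≠ 0 := by
    have := bj_norm_pos 0 hx
    simp only [hR]
    positivity
  simp only [Pi.div_apply]
  field_simp

lemma jd1_cont (n : ℕ) : ContinuousOn (fun x => (n:ℝ) / x * besselJ n x - besselJ (n+1) x) (Ioi 0) := by
  have := (bj_cont n).continuousOn (s := Ioi 0)
  have := (bj_cont (n+1)).continuousOn (s := Ioi 0)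
  have h : ContinuousOn (fun x : ℝ => (n:ℝ) / x) (Ioi 0) :=
    continuousOn_const.div continuousOn_id (fun x hx => ne_of_gt hx)
  fun_prop

lemma jd2_cont (n : ℕ) : ContinuousOn (fun x => besselJ n x - ((n:ℝ)+1) / x * besselJ (n+1) x) (Ioi 0) := by
  have := (bj_cont n).continuousOn (s := Ioi 0)
  have := (bj_cont (n+1)).continuousOn (s := Ioi 0)
  have h : ContinuousOn (fun x : ℝ => ((n:ℝ)+1) / x) (Ioi 0) :=
    continuousOn_const.div continuousOn_id (fun x hx => ne_of_gt hx)
  fun_prop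

lemma alpha_zero : ∃ α : ℝ → ℝ, ContinuousOn α (Ioi 0) ∧ (∀ x, 0 < x → AngleAt (besselJ 0) (besselJ 1) α x)
    ∧ (0 < α 1 ∧ α 1 < π/2) ∧ Tendsto (fun x => α x - x) atTop (𝓝 (-(π/4))) := by
  obtain ⟨α, h1, h2⟩ := lift_exists 0 (besselJ 0) (besselJ 1) _ _ (fun x hx => bj_d1 0 hx)
    (fun x hx => bj_d2 0 hx) (jd1_cont 0) (jd2_cont 0) (fun x hx => bj_norm_pos 0 hx) 1 one_pos 0
  have hA := fun x hx => (h2 x hx).2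
  have hd : ∀ x, 0 < x → HasDerivAt α (1 - Real.sin (α x) * Real.cos (α x) / x) x := by
    intro x hx
    refine (h2 x hx).1.congr_deriv ?_
    obtain ⟨r, hr, hu, hv⟩ := hA x hx
    simp only [zero_add, hu, hv]
    have hcs := Real.sin_sq_add_cos_sq (α x)
    have : (r * Real.cos (α x))^2 + (r * Real.sin (α x))^2 = r^2 := by
      linear_combination r^2 * hcs
    rw [this]
    field_simp
    push_cast
    linear_combination x * hcs
  have hp := Real.pi_gt_d2
  have hp2 := Real.pi_lt_d2
  have ha1 : 0 < α 1 ∧ α 1 < π/2 := by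
    obtain ⟨r, hr, hu, hv⟩ := hA 1 one_pos
    have j0 := bj_pos_one 0 1 one_pos le_rfl
    have j1 := bj_pos_one 1 1 one_pos le_rfl
    rw [hu] at j0
    rw [hv] at j1
    rw [sub_zero, abs_le] at h1
    exact quadrant (by linarith) h1.2 (pos_of_mul_pos_right j0 hr.le) (pos_of_mul_pos_right j1 hr.le)
  refine ⟨α, fun x hx => (hd x hx).continuousAt.continuousWithinAt, hA, ha1, ?_⟩
  -- bound
  have hB : ∀ x, 0 < x → HasDerivAt (fun x => α x - x - Real.cos (2 * α x) / (4 * x))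
      ((Real.cos (2 * α x) - Real.sin (2 * α x)^2) / (4 * x^2)) x := by
    intro x hx
    have d1 := ((hd x hx).const_mul 2).cos.fun_div ((hasDerivAt_id x).const_mul 4) (by simp; exact hx.ne')
    refine (((hd x hx).fun_sub (hasDerivAt_id x)).fun_sub d1).congr_deriv ?_
    simp only [id]
    rw [Real.sin_two_mul]
    field_simp
    ring
  have hI : ∀ x, 0 < x → HasDerivAt (fun x : ℝ => 1 / (2 * x)) (-(1 / (2 * x^2))) x := by
    intro x hx
    refine ((hasDerivAt_const x (1:ℝ)).fun_div ((hasDerivAt_id x).const_mul 2) (by simp; exact hx.ne')).congr_deriv ?_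
    simp only [id]; field_simp; ring
  have hbd : ∀ x, 0 < x → |(Real.cos (2 * α x) - Real.sin (2 * α x)^2) / (4 * x^2)| ≤ 1 / (2 * x^2) := by
    intro x hx
    rw [abs_div, abs_of_pos (show 0 < 4 * x^2 by positivity), div_le_div_iff₀ (by positivity) (by positivity)]
    have : |Real.cos (2 * α x) - Real.sin (2 * α x)^2| ≤ 2 := by
      have a1 := Real.cos_le_one (2 * α x)
      have a2 := Real.neg_one_le_cos (2 * α x)
      have a3 := Real.sin_sq_add_cos_sq (2 * α x)
      rw [abs_le]; constructor <;> nlinarith [sq_nonneg (Real.sin (2 * α x)), sq_nonneg (Real.cos (2 * α x))]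
    nlinarith [sq_nonneg x]
  have m1 : AntitoneOn (fun x => (α x - x - Real.cos (2 * α x) / (4 * x)) + 1 / (2 * x)) (Ici 1) := by
    apply antitoneOn_of_deriv_nonpos (convex_Ici 1)
    · intro x hx
      have hx : 0 < x := lt_of_lt_of_le one_pos hx
      exact ((hB x hx).fun_add (hI x hx)).continuousAt.continuousWithinAt
    · intro x hx
      rw [interior_Ici] at hx
      have hx : 0 < x := one_pos.trans hx
      exact ((hB x hx).fun_add (hI x hx)).differentiableAt.differentiableWithinAt
    · intro x hx
      rw [interior_Ici] at hx
      have hx : 0 < x := one_pos.trans hx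
      rw [((hB x hx).fun_add (hI x hx)).deriv]
      linarith [(abs_le.1 (hbd x hx)).2]
  have m2 : MonotoneOn (fun x => (α x - x - Real.cos (2 * α x) / (4 * x)) - 1 / (2 * x)) (Ici 1) := by
    apply monotoneOn_of_deriv_nonneg (convex_Ici 1)
    · intro x hx
      have hx : 0 < x := lt_of_lt_of_le one_pos hx
      exact ((hB x hx).fun_sub (hI x hx)).continuousAt.continuousWithinAt
    · intro x hx
      rw [interior_Ici] at hx
      have hx : 0 < x := one_pos.trans hx
      exact ((hB x hx).fun_sub (hI x hx)).differentiableAt.differentiableWithinAt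
    · intro x hx
      rw [interior_Ici] at hx
      have hx : 0 < x := one_pos.trans hx
      rw [((hB x hx).fun_sub (hI x hx)).deriv]
      linarith [(abs_le.1 (hbd x hx)).1]
  have hb : ∀ x, 1 ≤ x → |α x - x| ≤ 2 := by
    intro x hx
    have hx0 : 0 < x := by linarith
    have b1 := m1 (mem_Ici.2 le_rfl) (mem_Ici.2 hx) hx
    have b2 := m2 (mem_Ici.2 le_rfl) (mem_Ici.2 hx) hx
    simp only at b1 b2
    have c1 : |Real.cos (2 * α x) / (4 * x)| ≤ 1/4 := by
      rw [abs_div, abs_of_pos (show 0 < 4 * x by positivity), div_le_div_iff₀ (by positivity) (by positivity)]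
      have := Real.abs_cos_le_one (2 * α x)
      linarith
    have c2 : |Real.cos (2 * α 1) / (4 * 1)| ≤ 1/4 := by
      rw [abs_div, abs_of_pos (show 0 < 4 * (1:ℝ) by positivity), div_le_div_iff₀ (by positivity) (by positivity)]
      have := Real.abs_cos_le_one (2 * α 1)
      linarith
    rw [abs_le] at c1 c2
    have c3 : 0 < x⁻¹ := by positivity
    rw [abs_le]; constructor
    · norm_num at b1 b2 c2; linarith
    · norm_num at b1 b2 c2; linarith
  have hg := gamma_lim (fun x => 2 * (α x - x) + π/2) ?_ ?_
  · have := (hg.sub_const (π/2)).const_mul (1/2)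
    refine (this.congr fun x => ?_).trans (le_of_eq ?_)
    · ring
    · congr 1; ring
  · filter_upwards [eventually_ge_atTop 1] with x hx
    have := abs_le.1 (hb x hx)
    rw [abs_le]; constructor <;> linarith
  · have := (J01_sin α hA).neg
    simp only [neg_neg] at this
    refine this.congr fun x => ?_
    rw [Real.cos_add_pi_div_two]

lemma alpha_n (n : ℕ) : ∃ α : ℝ → ℝ, ContinuousOn α (Ioi 0) ∧
    (∀ x, 0 < x → AngleAt (besselJ n) (besselJ (n+1)) α x)
    ∧ (0 < α 1 ∧ α 1 < π/2) ∧ Tendsto (fun x => α x - x + n * (π/2)) atTop (𝓝 (-(π/4))) := by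
  induction n with
  | zero =>
    obtain ⟨α, h1, h2, h3, h4⟩ := alpha_zero
    exact ⟨α, h1, h2, h3, by simpa using h4⟩
  | succ n ih =>
    obtain ⟨α, h1, h2, h3, h4⟩ := ih
    have hA : ∀ x, 0 < x → AngleAt (besselJ (n+1)) (fun x => - besselJ n x) (fun x => α x - π/2) x := by
      intro x hx
      obtain ⟨r, hr, hu, hv⟩ := h2 x hx
      refine ⟨r, hr, ?_, ?_⟩
      · rw [Real.cos_sub_pi_div_two, hv]
      · simp only [Real.sin_sub_pi_div_two, hu]; ring
    have hrel : ∀ x, 0 < x → besselJ (n+1+1) x = (2*((n:ℝ)+1)/x) * besselJ (n+1) x + 1 * (- besselJ n x) := by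
      intro x hx
      rw [show n+1+1 = n+2 from rfl, bj_three n hx]; ring
    obtain ⟨θ, hθ⟩ := shear_lift 0 (besselJ (n+1)) (fun x => - besselJ n x) (besselJ (n+1+1)) (fun x => α x - π/2)
      _ _ (fun x => 2*((n:ℝ)+1)/x) (fun x => 1) (h1.sub continuousOn_const) hA
      (fun x hx => bj_d1 (n+1) hx) (fun x hx => bj_d2 (n+1) hx) (jd1_cont (n+1)) (jd2_cont (n+1)) (fun x hx => one_pos) hrel
    refine ⟨θ, fun x hx => (hθ x hx).1.continuousAt.continuousWithinAt, fun x hx => (hθ x hx).2.1, ?_, ?_⟩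
    · obtain ⟨r, hr, hu, hv⟩ := (hθ 1 one_pos).2.1
      have j0 := bj_pos_one (n+1) 1 one_pos le_rfl
      have j1 := bj_pos_one (n+1+1) 1 one_pos le_rfl
      rw [hu] at j0
      rw [hv] at j1
      have := abs_lt.1 (hθ 1 one_pos).2.2
      exact quadrant (by linarith) (by linarith) (pos_of_mul_pos_right j0 hr.le) (pos_of_mul_pos_right j1 hr.le)
    · have ht := shear_tendsto (besselJ (n+1)) (fun x => - besselJ n x) (besselJ (n+1+1)) (fun x => α x - π/2) θ
        (fun x => 2*((n:ℝ)+1)/x) (fun x => 1) (by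
          filter_upwards [eventually_gt_atTop 0] with x hx
          exact ⟨hA x hx, (hθ x hx).2.1, hrel x hx, (hθ x hx).2.2⟩)
        (tendsto_const_nhds.div_atTop tendsto_id) tendsto_const_nhds
      have := ht.add h4
      rw [zero_add] at this
      refine this.congr fun x => ?_
      push_cast; ring


noncomputable def wf (n : ℕ) (x : ℝ) : ℝ := √(x^2 - (n:ℝ)^2)
noncomputable def rf (n : ℕ) (x : ℝ) : ℝ := x^2 / (2 * (x^2 - (n:ℝ)^2))
noncomputable def xi (n : ℕ) (x : ℝ) : ℝ := wf n x - n * Real.arccos (n / x)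
noncomputable def vf (n : ℕ) (x : ℝ) : ℝ := (x * besselJ (n+1) x - (n + rf n x) * besselJ n x) / wf n x
noncomputable def vf' (n : ℕ) (x : ℝ) : ℝ :=
  ((wf n x ^ 2 + x^2 * n^2 / (x^2 - (n:ℝ)^2)^2 + 2 * rf n x ^ 2) * besselJ n x
    + rf n x * (n * besselJ n x - x * besselJ (n+1) x)) / (wf n x * x)

lemma q_pos {n : ℕ} {x : ℝ} (hx : (n:ℝ) < x) : 0 < x^2 - (n:ℝ)^2 := by
  have : (0:ℝ) ≤ n := n.cast_nonneg
  nlinarith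

lemma wf_pos {n : ℕ} {x : ℝ} (hx : (n:ℝ) < x) : 0 < wf n x := Real.sqrt_pos.2 (q_pos hx)

lemma wf_sq {n : ℕ} {x : ℝ} (hx : (n:ℝ) < x) : wf n x ^ 2 = x^2 - (n:ℝ)^2 := Real.sq_sqrt (q_pos hx).le

lemma n_pos_of {n : ℕ} {x : ℝ} (hx : (n:ℝ) < x) : 0 < x := lt_of_le_of_lt n.cast_nonneg hx

lemma wf_d {n : ℕ} {x : ℝ} (hx : (n:ℝ) < x) : HasDerivAt (wf n) (x / wf n x) x := by
  have h := (((hasDerivAt_id x).fun_pow 2).sub_const ((n:ℝ)^2)).sqrt (q_pos hx).ne'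
  refine h.congr_deriv ?_
  have := wf_pos hx
  simp only [id]
  unfold wf at *
  field_simp
  norm_num

lemma rf_d {n : ℕ} {x : ℝ} (hx : (n:ℝ) < x) :
    HasDerivAt (rf n) (-(x * n^2 / (x^2 - (n:ℝ)^2)^2)) x := by
  have hq := q_pos hx
  have h := ((hasDerivAt_id x).fun_pow 2).fun_div ((((hasDerivAt_id x).fun_pow 2).sub_const ((n:ℝ)^2)).const_mul 2)
    (by simp only [id]; positivity)
  refine h.congr_deriv ?_
  simp only [id]
  field_simp
  ring

lemma vf_d {n : ℕ} {x : ℝ} (hx : (n:ℝ) < x) : HasDerivAt (vf n) (vf' n x) x := by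
  have hq := q_pos hx
  have hx0 := n_pos_of hx
  have hw := wf_pos hx
  have hw2 := wf_sq hx
  have h := (((hasDerivAt_id x).fun_mul (bj_d2 n hx0)).fun_sub (((rf_d hx).const_add (n:ℝ)).fun_mul (bj_d1 n hx0))).fun_div
    (wf_d hx) hw.ne'
  refine h.congr_deriv ?_
  simp only [id]
  unfold vf'
  have hr : x^2 = 2 * rf n x * wf n x ^ 2 := by
    rw [hw2]; unfold rf; field_simp
  rw [show x^2 * (n:ℝ)^2 / (x^2 - (n:ℝ)^2)^2 = x * (x * (n:ℝ)^2 / (x^2 - (n:ℝ)^2)^2) by ring]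
  generalize x * (n:ℝ)^2 / (x^2 - (n:ℝ)^2)^2 = T
  generalize besselJ n x = J
  generalize besselJ (n+1) x = K
  generalize wf n x = w at *
  generalize rf n x = ρ at *
  field_simp
  linear_combination ((n + ρ) * J - x * K) * hr - w^2 * J * hw2

lemma vf'_cont (n : ℕ) : ContinuousOn (vf' n) (Ioi (n:ℝ)) := by
  have h1 := (bj_cont n).continuousOn (s := Ioi (n:ℝ))
  have h2 := (bj_cont (n+1)).continuousOn (s := Ioi (n:ℝ))
  have h3 : ContinuousOn (wf n) (Ioi (n:ℝ)) := fun x hx => (wf_d hx).continuousAt.continuousWithinAt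
  have h4 : ContinuousOn (rf n) (Ioi (n:ℝ)) := fun x hx => (rf_d hx).continuousAt.continuousWithinAt
  have h5 : ContinuousOn (fun x : ℝ => x^2 * (n:ℝ)^2 / (x^2 - (n:ℝ)^2)^2) (Ioi (n:ℝ)) :=
    (by fun_prop : Continuous (fun x : ℝ => x^2 * (n:ℝ)^2)).continuousOn.div (by fun_prop : Continuous _).continuousOn
      (fun x hx => (pow_pos (q_pos hx) 2).ne')
  unfold vf'
  refine ContinuousOn.div ?_ (h3.mul continuousOn_id) (fun x hx => (mul_pos (wf_pos hx) (n_pos_of hx)).ne')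
  fun_prop

lemma xi_d {n : ℕ} {x : ℝ} (hx : (n:ℝ) < x) : HasDerivAt (xi n) (wf n x / x) x := by
  have hx0 := n_pos_of hx
  have hq := q_pos hx
  have hw := wf_pos hx
  have hn : (0:ℝ) ≤ n := n.cast_nonneg
  have hlt : (n:ℝ)/x < 1 := by rw [div_lt_one hx0]; exact hx
  have hge : 0 ≤ (n:ℝ)/x := by positivity
  have d1 : HasDerivAt (fun x : ℝ => (n:ℝ)/x) (-(n/x^2)) x := by
    refine ((hasDerivAt_const x (n:ℝ)).fun_div (hasDerivAt_id x) hx0.ne').congr_deriv ?_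
    simp only [id]; ring
  have d2 := (Real.hasDerivAt_arccos (x := (n:ℝ)/x) (by linarith) hlt.ne).comp x d1
  have e : √(1 - ((n:ℝ)/x)^2) = wf n x / x := by
    rw [show 1 - ((n:ℝ)/x)^2 = (x^2 - (n:ℝ)^2) / x^2 by field_simp, Real.sqrt_div hq.le, Real.sqrt_sq hx0.le]; rfl
  rw [e] at d2
  refine ((wf_d hx).fun_sub (d2.const_mul (n:ℝ))).congr_deriv ?_
  have hw2 := wf_sq hx
  field_simp
  linarith

lemma wf_lim (n : ℕ) : Tendsto (fun x => wf n x - x) atTop (𝓝 0) := by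
    have h4 : Tendsto (fun x : ℝ => (n:ℝ)^2/x) atTop (𝓝 0) := tendsto_const_nhds.div_atTop tendsto_id
    apply squeeze_zero_norm' _ h4
    filter_upwards [eventually_gt_atTop (n:ℝ)] with x hx
    have hx0 := n_pos_of hx
    have hw := wf_pos hx
    have hw2 := wf_sq hx
    rw [Real.norm_eq_abs, le_div_iff₀ hx0]
    have hle : wf n x ≤ x := by
      apply le_of_sq_le_sq _ hx0.le
      rw [hw2]; nlinarith
    rw [abs_of_nonpos (by linarith)]
    nlinarith

lemma xi_lim (n : ℕ) : Tendsto (fun x => xi n x - x + n * (π/2)) atTop (𝓝 0) := by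
  have h1 : Tendsto (fun x : ℝ => (n:ℝ)/x) atTop (𝓝 0) := tendsto_const_nhds.div_atTop tendsto_id
  have h2 : Tendsto (fun x : ℝ => Real.arccos ((n:ℝ)/x)) atTop (𝓝 (π/2)) := by
    have := (Real.continuous_arccos.tendsto 0).comp h1
    rw [Real.arccos_zero] at this; exact this
  have h3 := wf_lim n
  have := h3.sub ((h2.const_mul (n:ℝ)).sub_const (n * (π/2)))
  simp only [sub_self] at this
  refine this.congr fun x => ?_
  unfold xi; ring

lemma psi_exists (n : ℕ) (α : ℝ → ℝ) (hα : ContinuousOn α (Ioi 0))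
    (hA : ∀ x, 0 < x → AngleAt (besselJ n) (besselJ (n+1)) α x)
    (hlim : Tendsto (fun x => α x - x + n * (π/2)) atTop (𝓝 (-(π/4)))) :
    ∃ ψ : ℝ → ℝ, (∀ x, (n:ℝ) < x → AngleAt (besselJ n) (vf n) ψ x ∧ |ψ x - α x| < π ∧
      ∃ e, HasDerivAt ψ (wf n x / x + e) x ∧ 0 ≤ e ∧
        e ≤ (rf n x ^ 2 + x^2 * n^2 / (x^2 - (n:ℝ)^2)^2) / (wf n x * x)) ∧
      Tendsto (fun x => ψ x - xi n x) atTop (𝓝 (-(π/4))) := by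
  have hn : (0:ℝ) ≤ n := n.cast_nonneg
  have hrel : ∀ x, (n:ℝ) < x → vf n x = (-(n + rf n x) / wf n x) * besselJ n x + (x / wf n x) * besselJ (n+1) x := by
    intro x hx
    unfold vf; ring
  obtain ⟨ψ, hψ⟩ := shear_lift (n:ℝ) (besselJ n) (besselJ (n+1)) (vf n) α _ (vf' n)
    (fun x => -(n + rf n x) / wf n x) (fun x => x / wf n x) (hα.mono (Ioi_subset_Ioi hn))
    (fun x hx => hA x (n_pos_of hx)) (fun x hx => bj_d1 n (n_pos_of hx)) (fun x hx => vf_d hx)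
    ((jd1_cont n).mono (Ioi_subset_Ioi hn)) (vf'_cont n)
    (fun x hx => div_pos (n_pos_of hx) (wf_pos hx)) hrel
  refine ⟨ψ, fun x hx => ⟨(hψ x hx).2.1, (hψ x hx).2.2, ?_⟩, ?_⟩
  · have hx0 := n_pos_of hx
    have hq := q_pos hx
    have hw := wf_pos hx
    have hw2 := wf_sq hx
    obtain ⟨r, hr, hu, hv⟩ := (hψ x hx).2.1
    have hS : 0 < besselJ n x ^ 2 + vf n x ^ 2 := by
      rw [hu, hv, show (r * Real.cos (ψ x))^2 + (r * Real.sin (ψ x))^2 = r^2 by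
        linear_combination r^2 * Real.sin_sq_add_cos_sq (ψ x)]
      positivity
    have hE : 0 ≤ (rf n x ^ 2 + x^2 * n^2 / (x^2 - (n:ℝ)^2)^2) / (wf n x * x) := by positivity
    refine ⟨(rf n x ^ 2 + x^2 * n^2 / (x^2 - (n:ℝ)^2)^2) / (wf n x * x) * (besselJ n x ^ 2 / (besselJ n x ^ 2 + vf n x ^ 2)), ?_, ?_, ?_⟩
    · refine (hψ x hx).1.congr_deriv ?_
      rw [div_eq_iff hS.ne', add_mul, mul_assoc, div_mul_cancel₀ _ hS.ne']
      unfold vf vf'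
      generalize x^2 * (n:ℝ)^2 / (x^2 - (n:ℝ)^2)^2 = T
      field_simp
      ring
    · positivity
    · apply mul_le_of_le_one_right hE
      rw [div_le_one hS]
      nlinarith [sq_nonneg (vf n x)]
  · have hw0 : Tendsto (fun x => x / wf n x) atTop (𝓝 1) := by
      have h1 : Tendsto (fun x => 1 + (wf n x - x) / x) atTop (𝓝 1) := by
        simpa using ((wf_lim n).div_atTop tendsto_id).const_add 1
      have h2 := h1.inv₀ one_ne_zero
      rw [inv_one] at h2
      refine h2.congr' ?_
      filter_upwards [eventually_gt_atTop (n:ℝ)] with x hx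
      have := n_pos_of hx
      have := wf_pos hx
      rw [show 1 + (wf n x - x) / x = wf n x / x by field_simp; ring, inv_div]
    have hwt : Tendsto (wf n) atTop atTop := by
      have := (wf_lim n).add_atTop tendsto_id
      refine this.congr fun x => ?_
      simp
    have hr1 : Tendsto (rf n) atTop (𝓝 (1^2/2)) := by
      refine ((hw0.pow 2).div_const 2).congr' ?_
      filter_upwards [eventually_gt_atTop (n:ℝ)] with x hx
      rw [div_pow, wf_sq hx]; unfold rf; field_simp
    have hr0 : Tendsto (fun x => -(n + rf n x) / wf n x) atTop (𝓝 0) := (hr1.const_add (n:ℝ)).neg.div_atTop hwt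
    have ht := shear_tendsto (besselJ n) (besselJ (n+1)) (vf n) α ψ
      (fun x => -(n + rf n x) / wf n x) (fun x => x / wf n x) (by
        filter_upwards [eventually_gt_atTop (n:ℝ)] with x hx
        exact ⟨hA x (n_pos_of hx), (hψ x hx).2.1, hrel x hx, (hψ x hx).2.2⟩) hr0 hw0
    have := (ht.add hlim).sub (xi_lim n)
    simp only [zero_add, sub_zero] at this
    refine this.congr fun x => ?_
    ring

lemma psi_upper (n : ℕ) (ψ : ℝ → ℝ) (h : ∀ x, (n:ℝ) < x →
      ∃ e, HasDerivAt ψ (wf n x / x + e) x ∧ 0 ≤ e ∧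
        e ≤ (rf n x ^ 2 + x^2 * n^2 / (x^2 - (n:ℝ)^2)^2) / (wf n x * x))
      (hl : Tendsto (fun x => ψ x - xi n x) atTop (𝓝 (-(π/4)))) (x : ℝ) (hx : (n:ℝ) < x) :
      ψ x - xi n x ≤ -(π/4) := by
  have hm : MonotoneOn (fun x => ψ x - xi n x) (Ici x) := by
    apply monotoneOn_of_deriv_nonneg (convex_Ici x)
    · intro y hy
      have hy : (n:ℝ) < y := lt_of_lt_of_le hx hy
      obtain ⟨e, he, _⟩ := h y hy
      exact (he.fun_sub (xi_d hy)).continuousAt.continuousWithinAt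
    · intro y hy
      rw [interior_Ici] at hy
      have hy : (n:ℝ) < y := hx.trans hy
      obtain ⟨e, he, _⟩ := h y hy
      exact (he.fun_sub (xi_d hy)).differentiableAt.differentiableWithinAt
    · intro y hy
      rw [interior_Ici] at hy
      have hy : (n:ℝ) < y := hx.trans hy
      obtain ⟨e, he, h0, _⟩ := h y hy
      rw [(he.fun_sub (xi_d hy)).deriv]
      linarith
  refine ge_of_tendsto hl ?_
  filter_upwards [eventually_ge_atTop x] with y hy
  exact hm (mem_Ici.2 le_rfl) (mem_Ici.2 hy) hy

lemma cond_lt {n : ℕ} {x M : ℝ} (hM : 1 ≤ M) (hx : 0 < x) (hC : x^2 ≤ M^2 * (x^2 - (n:ℝ)^2)) : (n:ℝ) < x := by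
  have hn : (0:ℝ) ≤ n := n.cast_nonneg
  by_contra hcon
  push Not at hcon
  have : x^2 - (n:ℝ)^2 ≤ 0 := by nlinarith
  nlinarith [sq_nonneg M, pow_pos hx 2, mul_nonneg (sq_nonneg M) (neg_nonneg.2 this)]

lemma cond_mono {n : ℕ} {x y M : ℝ} (hM : 1 ≤ M) (hx : 0 < x) (hC : x^2 ≤ M^2 * (x^2 - (n:ℝ)^2)) (hy : x ≤ y) :
    y^2 ≤ M^2 * (y^2 - (n:ℝ)^2) := by
  have h1 : x^2 ≤ y^2 := by nlinarith
  have h2 : 0 ≤ M^2 - 1 := by nlinarith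
  nlinarith [mul_le_mul_of_nonneg_left h1 h2]

lemma cond_w {n : ℕ} {x M : ℝ} (hM : 1 ≤ M) (hx : 0 < x) (hC : x^2 ≤ M^2 * (x^2 - (n:ℝ)^2)) :
    x ≤ M * wf n x := by
  have hlt := cond_lt hM hx hC
  have := wf_pos hlt
  apply le_of_sq_le_sq _ (by positivity)
  rw [mul_pow, wf_sq hlt]; exact hC

lemma cond_r {n : ℕ} {x M : ℝ} (hM : 1 ≤ M) (hx : 0 < x) (hC : x^2 ≤ M^2 * (x^2 - (n:ℝ)^2)) :
    0 ≤ rf n x ∧ rf n x ≤ M^2 / 2 := by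
  have hq := q_pos (cond_lt hM hx hC)
  unfold rf
  constructor
  · positivity
  · rw [div_le_div_iff₀ (by positivity) (by norm_num)]; linarith

lemma psi_lower (n : ℕ) (ψ : ℝ → ℝ) (h : ∀ x, (n:ℝ) < x →
      ∃ e, HasDerivAt ψ (wf n x / x + e) x ∧ 0 ≤ e ∧
        e ≤ (rf n x ^ 2 + x^2 * n^2 / (x^2 - (n:ℝ)^2)^2) / (wf n x * x))
      (hl : Tendsto (fun x => ψ x - xi n x) atTop (𝓝 (-(π/4)))) (M : ℝ) (hM : 1 ≤ M) (x : ℝ) (hx : 0 < x)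
      (hC : x^2 ≤ M^2 * (x^2 - (n:ℝ)^2)) :
      -(π/4) - 2 * M^5 / x ≤ ψ x - xi n x := by
  have hI : ∀ x, 0 < x → HasDerivAt (fun x : ℝ => 2 * M^5 / x) (-(2 * M^5 / x^2)) x := by
    intro x hx
    refine ((hasDerivAt_const x (2 * M^5)).fun_div (hasDerivAt_id x) hx.ne').congr_deriv ?_
    simp only [id]; ring
  have hb : ∀ y, x ≤ y → (rf n y ^ 2 + y^2 * n^2 / (y^2 - (n:ℝ)^2)^2) / (wf n y * y) ≤ 2 * M^5 / y^2 := by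
    intro y hxy
    have hy : 0 < y := by linarith
    have hCy := cond_mono hM hx hC hxy
    have hlt := cond_lt hM hy hCy
    have hq := q_pos hlt
    have hw := wf_pos hlt
    have a1 := cond_w hM hy hCy
    have a2 := cond_r hM hy hCy
    have a3 : y^2 * n^2 / (y^2 - (n:ℝ)^2)^2 ≤ M^4 := by
      rw [div_le_iff₀ (by positivity)]
      have : (n:ℝ)^2 ≤ y^2 := by linarith
      calc y^2 * (n:ℝ)^2 ≤ y^2 * y^2 := by gcongr
        _ ≤ (M^2 * (y^2 - (n:ℝ)^2)) * (M^2 * (y^2 - (n:ℝ)^2)) := by gcongr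
        _ = _ := by ring
    have a4 : rf n y ^ 2 ≤ M^4/4 := by
      calc rf n y ^ 2 ≤ (M^2/2)^2 := by gcongr; exact a2.1; exact a2.2
        _ = _ := by ring
    rw [div_le_div_iff₀ (by positivity) (by positivity)]
    have : (rf n y ^ 2 + y^2 * n^2 / (y^2 - (n:ℝ)^2)^2) ≤ 2 * M^4 := by
      have : 0 < M^4 := by positivity
      linarith
    calc _ ≤ 2 * M^4 * y^2 := by gcongr
      _ = 2 * M^4 * y * y := by ring
      _ ≤ 2 * M^4 * (M * wf n y) * y := by gcongr
      _ = _ := by ring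
  have hm : AntitoneOn (fun x => (ψ x - xi n x) + 2 * M^5 / x) (Ici x) := by
    have hlt := cond_lt hM hx hC
    apply antitoneOn_of_deriv_nonpos (convex_Ici x)
    · intro y hy
      have hy : (n:ℝ) < y := lt_of_lt_of_le hlt hy
      obtain ⟨e, he, _⟩ := h y hy
      exact ((he.fun_sub (xi_d hy)).fun_add (hI y (n_pos_of hy))).continuousAt.continuousWithinAt
    · intro y hy
      rw [interior_Ici] at hy
      have hy : (n:ℝ) < y := hlt.trans hy
      obtain ⟨e, he, _⟩ := h y hy
      exact ((he.fun_sub (xi_d hy)).fun_add (hI y (n_pos_of hy))).differentiableAt.differentiableWithinAt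
    · intro y hy
      rw [interior_Ici] at hy
      have hb' := hb y (le_of_lt hy)
      have hy : (n:ℝ) < y := hlt.trans hy
      obtain ⟨e, he, h0, h1⟩ := h y hy
      rw [((he.fun_sub (xi_d hy)).fun_add (hI y (n_pos_of hy))).deriv]
      linarith
  have hl2 : Tendsto (fun x => (ψ x - xi n x) + 2 * M^5 / x) atTop (𝓝 (-(π/4))) := by
    have := hl.add (tendsto_const_nhds (x := 2 * M^5).div_atTop tendsto_id)
    rw [add_zero] at this; exact this
  have := le_of_tendsto hl2 (b := (ψ x - xi n x) + 2 * M^5 / x) (by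
    filter_upwards [eventually_ge_atTop x] with y hy
    exact hm (mem_Ici.2 le_rfl) (mem_Ici.2 hy) hy)
  linarith


noncomputable def tf (σ : ℝ) (n : ℕ) (x : ℝ) : ℝ := x * besselJ (n+1) x - (n + σ) * besselJ n x

lemma tf_eq (σ : ℝ) (n : ℕ) (x : ℝ) : tf σ n x = - phiRobin σ n x := by
  rw [phi_eq]; unfold tf; ring

lemma tf_d (σ : ℝ) (n : ℕ) {x : ℝ} (hx : 0 < x) : HasDerivAt (tf σ n)
    (((x^2 - (n:ℝ)^2) * besselJ n x - σ * (n * besselJ n x - x * besselJ (n+1) x)) / x) x := by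
  refine (((hasDerivAt_id x).fun_mul (bj_d2 n hx)).fun_sub ((bj_d1 n hx).const_mul ((n:ℝ)+σ))).congr_deriv ?_
  simp only [id]
  field_simp
  ring

lemma tf_dc (σ : ℝ) (n : ℕ) : ContinuousOn (fun x : ℝ =>
    (((x^2 - (n:ℝ)^2) * besselJ n x - σ * (n * besselJ n x - x * besselJ (n+1) x)) / x)) (Ioi 0) := by
  have h1 := (bj_cont n)
  have h2 := (bj_cont (n+1))
  exact (by fun_prop : Continuous _).continuousOn.div continuousOn_id (fun x hx => ne_of_gt hx)

lemma start_pt (σ : ℝ) (hσ : 0 < σ) (n : ℕ) : ∃ a : ℝ, 0 < a ∧ (n:ℝ) ≤ a ∧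
    (∀ x, 0 < x → x ≤ a → tf σ n x < 0) ∧ (∀ x, 0 < x → x ≤ max 1 a → 0 < besselJ n x) := by
  rcases Nat.eq_zero_or_pos n with h | h
  · subst h
    have hc : Continuous (tf σ 0) := by
      unfold tf
      have h1 := (bj_cont 0)
      have h2 := (bj_cont (0+1))
      fun_prop
    have h0 : tf σ 0 0 < 0 := by
      unfold tf
      have := bj_zero_pos (x := 0) le_rfl zero_le_one
      have := mul_pos hσ this
      simp; linarith
    have := hc.continuousAt.eventually_lt continuousAt_const h0
    obtain ⟨ε, hε, hb⟩ := Metric.eventually_nhds_iff.1 this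
    refine ⟨min 1 (ε/2), by positivity, by simp; positivity, ?_, ?_⟩
    · intro x hx hxa
      apply hb
      rw [Real.dist_eq, sub_zero, abs_of_pos hx]
      have := min_le_right 1 (ε/2)
      linarith
    · intro x hx hxa
      rw [max_eq_left (min_le_left _ _)] at hxa
      exact bj_pos_one 0 x hx hxa
  · have hn : (1:ℝ) ≤ n := by exact_mod_cast h
    refine ⟨n, by linarith, le_rfl, ?_, ?_⟩
    · intro x hx hxa
      have := bj_pos_n n h x hx hxa
      unfold tf
      nlinarith
    · intro x hx hxa
      rw [max_eq_right hn] at hxa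
      exact (bj_pos_n n h x hx hxa).1

lemma theta_exists (σ : ℝ) (hσ : 0 < σ) (n : ℕ) (α : ℝ → ℝ) (hα : ContinuousOn α (Ioi 0))
    (hA : ∀ x, 0 < x → AngleAt (besselJ n) (besselJ (n+1)) α x) (hα1 : 0 < α 1 ∧ α 1 < π/2) :
    ∃ Θ : ℝ → ℝ, (∀ x, 0 < x → AngleAt (besselJ n) (tf σ n) Θ x ∧ |Θ x - α x| < π) ∧
      ∀ κ, 0 < κ → phiRobin σ n κ = 0 → (n:ℝ) < κ ∧
        Θ κ = (({t : ℝ | t ∈ Set.Ioo 0 κ ∧ phiRobin σ n t = 0}).ncard : ℝ) * π := by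
  have hp := Real.pi_pos
  obtain ⟨Θ, hΘ⟩ := shear_lift 0 (besselJ n) (besselJ (n+1)) (tf σ n) α _ _
    (fun x => -((n:ℝ) + σ)) (fun x => x) hα hA (fun x hx => bj_d1 n hx) (fun x hx => tf_d σ n hx)
    (jd1_cont n) (tf_dc σ n) (fun x hx => hx) (fun x hx => by unfold tf; ring)
  refine ⟨Θ, fun x hx => (hΘ x hx).2, ?_⟩
  obtain ⟨a, ha0, han, hat, haJ⟩ := start_pt σ hσ n
  have hcont : ContinuousOn Θ (Ioi 0) := fun x hx => (hΘ x hx).1.continuousAt.continuousWithinAt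
  have hcosJ : ∀ x, 0 < x → x ≤ max 1 a → 0 < Real.cos (Θ x) := by
    intro x hx hxa
    obtain ⟨r, hr, hu, hv⟩ := (hΘ x hx).2.1
    have := haJ x hx hxa
    rw [hu] at this
    exact pos_of_mul_pos_right this hr.le
  have h1 : |Θ 1| < π/2 := by
    apply abs_lt_half _ (hcosJ 1 one_pos (le_max_left _ _))
    have := abs_lt.1 (hΘ 1 one_pos).2.2
    rw [abs_lt]; constructor <;> linarith
  have hS : ContinuousOn Θ (Ioc 0 (max 1 a)) := hcont.mono (fun x hx => hx.1)
  have h1S : (1:ℝ) ∈ Ioc 0 (max 1 a) := ⟨one_pos, le_max_left _ _⟩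
  have haS : a ∈ Ioc 0 (max 1 a) := ⟨ha0, le_max_right _ _⟩
  have hlt : Θ a < π/2 := lt_of_ne_conn isPreconnected_Ioc hS (c := π/2) (fun x hx he => by
    have := hcosJ x hx.1 hx.2
    rw [he, Real.cos_pi_div_two] at this
    exact lt_irrefl _ this) h1S (abs_lt.1 h1).2 a haS
  have hgt : -(π/2) < Θ a := gt_of_ne_conn isPreconnected_Ioc hS (c := -(π/2)) (fun x hx he => by
    have := hcosJ x hx.1 hx.2
    rw [he, Real.cos_neg, Real.cos_pi_div_two] at this
    exact lt_irrefl _ this) h1S (abs_lt.1 h1).1 a haS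
  have hneg : Θ a < 0 := by
    by_contra hcon
    push Not at hcon
    obtain ⟨r, hr, hu, hv⟩ := (hΘ a ha0).2.1
    have h2 := hat a ha0 le_rfl
    rw [hv] at h2
    have := Real.sin_nonneg_of_nonneg_of_le_pi hcon (by linarith)
    have := mul_nonneg hr.le this
    linarith
  have hmono : StrictMonoOn Θ (Ici a) := by
    apply strictMonoOn_of_deriv_pos (convex_Ici a)
    · exact hcont.mono (fun x hx => lt_of_lt_of_le ha0 hx)
    · intro x hx
      rw [interior_Ici] at hx
      have hx0 : 0 < x := ha0.trans hx
      have hnx : (n:ℝ) < x := lt_of_le_of_lt han hx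
      rw [(hΘ x hx0).1.deriv]
      obtain ⟨r, hr, hu, hv⟩ := (hΘ x hx0).2.1
      have hN : 0 < besselJ n x ^ 2 + tf σ n x ^ 2 := by
        rw [hu, hv, show (r * Real.cos (Θ x))^2 + (r * Real.sin (Θ x))^2 = r^2 by
          linear_combination r^2 * Real.sin_sq_add_cos_sq (Θ x)]
        positivity
      apply div_pos _ hN
      have e : besselJ n x * (((x^2 - (n:ℝ)^2) * besselJ n x - σ * (n * besselJ n x - x * besselJ (n+1) x)) / x)
        - tf σ n x * ((n:ℝ) / x * besselJ n x - besselJ (n+1) x) =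
        ((x^2 - (n:ℝ)^2) * besselJ n x ^ 2 + (n * besselJ n x - x * besselJ (n+1) x)^2) / x := by
        unfold tf; field_simp; ring
      rw [e]
      apply div_pos _ hx0
      have hq := q_pos hnx
      by_cases hJ : besselJ n x = 0
      · have := bj_norm_pos n hx0
        rw [hJ] at this ⊢
        have h3 : 0 < besselJ (n+1) x ^ 2 := by linarith
        have := mul_pos (pow_pos hx0 2) h3
        nlinarith
      · positivity
  have hzero : ∀ t, 0 < t → (phiRobin σ n t = 0 ↔ a < t ∧ Real.sin (Θ t) = 0) := by
    intro t ht
    obtain ⟨r, hr, hu, hv⟩ := (hΘ t ht).2.1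
    have e := tf_eq σ n t
    constructor
    · intro h0
      rw [h0, neg_zero] at e
      constructor
      · by_contra hcon
        push Not at hcon
        have := hat t ht hcon
        linarith
      · rw [e] at hv
        rcases mul_eq_zero.1 hv.symm with h | h
        · linarith
        · exact h
    · rintro ⟨_, h2⟩
      rw [h2] at hv
      linarith
  intro κ hκ hκ0
  obtain ⟨hκa, hκs⟩ := (hzero κ hκ).1 hκ0
  refine ⟨lt_of_le_of_lt han hκa, ?_⟩
  obtain ⟨m, hm⟩ := Real.sin_eq_zero_iff.1 hκs
  have hm0 : 0 ≤ m := by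
    have h2 := hmono (mem_Ici.2 le_rfl) (mem_Ici.2 hκa.le) hκa
    by_contra hcon
    have h3 : m ≤ -1 := by omega
    have h3 : (m:ℝ) ≤ -1 := by exact_mod_cast h3
    nlinarith
  lift m to ℕ using hm0
  have hm : (m:ℝ) * π = Θ κ := by exact_mod_cast hm
  rw [← hm]
  have hinj : InjOn Θ {t : ℝ | t ∈ Set.Ioo 0 κ ∧ phiRobin σ n t = 0} := by
    apply hmono.injOn.mono
    intro t ht
    exact ((hzero t ht.1.1).1 ht.2).1.le
  have himg : Θ '' {t : ℝ | t ∈ Set.Ioo 0 κ ∧ phiRobin σ n t = 0} = (fun j : ℕ => (j:ℝ) * π) '' (Finset.range m : Set ℕ) := by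
    ext y
    constructor
    · rintro ⟨t, ht, rfl⟩
      obtain ⟨hta, hts⟩ := (hzero t ht.1.1).1 ht.2
      obtain ⟨j, hj⟩ := Real.sin_eq_zero_iff.1 hts
      have b1 := hmono (mem_Ici.2 le_rfl) (mem_Ici.2 hta.le) hta
      have b2 := hmono (mem_Ici.2 hta.le) (mem_Ici.2 hκa.le) ht.1.2
      have hj0 : 0 ≤ j := by
        by_contra hcon
        have h3 : j ≤ -1 := by omega
        have h3 : (j:ℝ) ≤ -1 := by exact_mod_cast h3
        nlinarith
      lift j to ℕ using hj0
      have hj : (j:ℝ) * π = Θ t := by exact_mod_cast hj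
      refine ⟨j, ?_, hj⟩
      rw [← hj, ← hm] at b2
      have := lt_of_mul_lt_mul_right b2 hp.le
      simp
      exact_mod_cast this
    · rintro ⟨j, hj, rfl⟩
      simp at hj
      have hj' : (j:ℝ) < m := by exact_mod_cast hj
      have hjk : (j:ℝ) * π < Θ κ := by rw [← hm]; gcongr
      have hja : Θ a < (j:ℝ) * π := by
        have : 0 ≤ (j:ℝ) * π := by positivity
        linarith
      obtain ⟨t, ht, hte⟩ := intermediate_value_Ioo hκa.le
        (hcont.mono (fun x hx => lt_of_lt_of_le ha0 hx.1)) ⟨hja, hjk⟩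
      have ht0 : 0 < t := ha0.trans ht.1
      refine ⟨t, ⟨⟨ht0, ht.2⟩, (hzero t ht0).2 ⟨ht.1, ?_⟩⟩, hte⟩
      rw [hte, Real.sin_nat_mul_pi]
  have hcard := ncard_image_of_injOn hinj
  rw [himg, ncard_image_of_injective _ (fun i j hij => by
    have := mul_right_cancel₀ hp.ne' hij
    exact_mod_cast this), ncard_coe_finset, Finset.card_range] at hcard
  rw [← hcard]

lemma at_zero (σ : ℝ) (n : ℕ) (α ψ Θ : ℝ → ℝ) (x : ℝ) (hx : (n:ℝ) < x) (N : ℕ)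
    (h1 : AngleAt (besselJ n) (besselJ (n+1)) α x) (h2 : AngleAt (besselJ n) (vf n) ψ x)
    (h3 : AngleAt (besselJ n) (tf σ n) Θ x) (d1 : |ψ x - α x| < π) (d2 : |Θ x - α x| < π)
    (hN : Θ x = N * π) :
    |ψ x - N * π| < π/2 ∧ |ψ x - N * π| ≤ |(σ - rf n x) / wf n x| := by
  rw [← hN]
  have hs : Real.sin (Θ x) = 0 := by rw [hN, Real.sin_nat_mul_pi]
  have hcs := Real.sin_sq_add_cos_sq (Θ x)
  rw [hs] at hcs
  have hc : Real.cos (Θ x) ≠ 0 := by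
    intro h; rw [h] at hcs; norm_num at hcs
  obtain ⟨r1, hr1, u1, v1⟩ := h1
  obtain ⟨r2, hr2, u2, v2⟩ := h2
  obtain ⟨r3, hr3, u3, v3⟩ := h3
  have hJ : besselJ n x ≠ 0 := by rw [u3]; exact mul_ne_zero hr3.ne' hc
  have hJ2 : 0 < besselJ n x ^ 2 := by positivity
  have c1 : 0 < Real.cos (α x - Θ x) := by
    rw [Real.cos_sub, hs, mul_zero, add_zero]
    have : (r1 * r3) * (Real.cos (α x) * Real.cos (Θ x)) = besselJ n x ^ 2 := by
      rw [sq]; nth_rw 1 [u1]; rw [u3]; ring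
    rw [← this] at hJ2
    exact pos_of_mul_pos_right hJ2 (by positivity)
  have c2 : 0 < Real.cos (ψ x - Θ x) := by
    have hJ2 : 0 < besselJ n x ^ 2 := by positivity
    rw [Real.cos_sub, hs, mul_zero, add_zero]
    have : (r2 * r3) * (Real.cos (ψ x) * Real.cos (Θ x)) = besselJ n x ^ 2 := by
      rw [sq]; nth_rw 1 [u2]; rw [u3]; ring
    rw [← this] at hJ2
    exact pos_of_mul_pos_right hJ2 (by positivity)
  have e1 : |α x - Θ x| < π/2 := abs_lt_half (by rw [abs_sub_comm]; linarith [Real.pi_pos]) c1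
  have e2 : |ψ x - Θ x| < π/2 := by
    refine abs_lt_half ?_ c2
    have := abs_sub_le (ψ x) (α x) (Θ x)
    linarith
  refine ⟨e2, abs_le_of_tan e2 ?_⟩
  rw [Real.cos_sub, Real.sin_sub, hs]
  have hv : vf n x = (σ - rf n x) / wf n x * besselJ n x := by
    rw [hs, mul_zero] at v3
    unfold tf at v3
    unfold vf
    rw [show x * besselJ (n+1) x = (n+σ) * besselJ n x by linarith]
    ring
  rw [v2, u2] at hv
  have : Real.sin (ψ x) = (σ - rf n x) / wf n x * Real.cos (ψ x) := by
    apply mul_left_cancel₀ hr2.ne'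
    linarith
  rw [this]; ring


lemma xi_low {n : ℕ} {x y M : ℝ} (hM : 1 ≤ M) (hx : 0 < x) (hC : x^2 ≤ M^2 * (x^2 - (n:ℝ)^2)) (hxy : x ≤ y) :
    y - x ≤ M * (xi n y - xi n x) := by
  have hlt := cond_lt hM hx hC
  have hm : MonotoneOn (fun x => M * xi n x - x) (Ici x) := by
    apply monotoneOn_of_deriv_nonneg (convex_Ici x)
    · intro z hz
      have hz : (n:ℝ) < z := lt_of_lt_of_le hlt hz
      exact (((xi_d hz).const_mul M).fun_sub (hasDerivAt_id z)).continuousAt.continuousWithinAt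
    · intro z hz
      rw [interior_Ici] at hz
      have hz : (n:ℝ) < z := hlt.trans hz
      exact (((xi_d hz).const_mul M).fun_sub (hasDerivAt_id z)).differentiableAt.differentiableWithinAt
    · intro z hz
      rw [interior_Ici] at hz
      have hz0 : 0 < z := hx.trans hz
      have hw := cond_w hM hz0 (cond_mono hM hx hC (le_of_lt hz))
      have hz : (n:ℝ) < z := hlt.trans hz
      have e := (((xi_d hz).const_mul M).fun_sub (hasDerivAt_id z)).deriv
      simp only [id] at e
      rw [e]
      have : 1 ≤ M * (wf n z / z) := by rw [← mul_div_assoc, le_div_iff₀ hz0]; linarith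
      linarith
  have := hm (mem_Ici.2 le_rfl) (mem_Ici.2 hxy) hxy
  simp only at this
  linarith

lemma xi_le_wf (n : ℕ) (x : ℝ) : xi n x ≤ wf n x := by
  unfold xi
  have := mul_nonneg (n.cast_nonneg (α := ℝ)) (Real.arccos_nonneg ((n:ℝ)/x))
  linarith

lemma xi_gfun (n : ℕ) (f : ℝ) (hf : 0 < f) : π * (f * gfun (n / f)) = xi n f := by
  unfold gfun xi wf
  have e : f * √(1 - ((n:ℝ)/f)^2) = √(f^2 - (n:ℝ)^2) := by
    nth_rw 1 [← Real.sqrt_sq hf.le]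
    rw [← Real.sqrt_mul (by positivity)]
    congr 1; field_simp
  have := Real.pi_pos
  rw [← e]
  field_simp

lemma cond_of {n : ℕ} {x B : ℝ} (hx : 0 < x) (hn : (n:ℝ) ≤ x) (h : (n:ℝ) ≤ B * wf n x) :
    x^2 ≤ (1 + B^2)^2 * (x^2 - (n:ℝ)^2) := by
  have hn0 : (0:ℝ) ≤ n := n.cast_nonneg
  have hq : 0 ≤ x^2 - (n:ℝ)^2 := by nlinarith
  have hw : wf n x ^ 2 = x^2 - (n:ℝ)^2 := Real.sq_sqrt hq
  have h2 : (n:ℝ)^2 ≤ (B * wf n x)^2 := by gcongr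
  rw [mul_pow, hw] at h2
  nlinarith [mul_nonneg (sq_nonneg B) hq, mul_nonneg (sq_nonneg (B^2)) hq]

set_option maxHeartbeats 1000000 in
/-- Fix `σ > 0` and `c > 0`. Let `F x y` be the unique `t > 0` with `t ≥ x` and
`y = t·g(x/t)`, and let `κ n k` be the `k`-th positive zero of `φ_{n,σ}`. Then there are
`K > 0` and `k₀` such that for all `k ≥ k₀` and `0 ≤ n ≤ c·k`,
`|κ_{n,k} − F(n, k − 3/4)| ≤ K/k`. -/
theorem bessel_robin_zeros_large_k (σ c : ℝ) (hσ : 0 < σ) (hc : 0 < c)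
    (F : ℝ → ℝ → ℝ)
    (hF : ∀ x y : ℝ, 0 ≤ x → 0 ≤ y → ¬(x = 0 ∧ y = 0) →
      0 < F x y ∧ x ≤ F x y ∧ y = F x y * gfun (x / F x y))
    (κ : ℕ → ℕ → ℝ)
    (hκ : ∀ n k : ℕ, 1 ≤ k → 0 < κ n k ∧ phiRobin σ n (κ n k) = 0 ∧
      ({t : ℝ | t ∈ Set.Ioo 0 (κ n k) ∧ phiRobin σ n t = 0}).ncard = k - 1) :
    ∃ K : ℝ, 0 < K ∧ ∃ k₀ : ℕ, 1 ≤ k₀ ∧ ∀ k : ℕ, k₀ ≤ k → ∀ n : ℕ, (n : ℝ) ≤ c * k →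
      |κ n k - F (n : ℝ) ((k : ℝ) - 3/4)| ≤ K / k := by
  have hp := Real.pi_gt_d2
  have hp4 := Real.pi_lt_d2
  set B : ℝ := 2 * c / π with hB
  have hB0 : 0 < B := by positivity
  set M : ℝ := 1 + B^2 with hMd
  have hM : 1 ≤ M := by nlinarith
  set C : ℝ := (σ + M^2/2) * M + 2 * M^5 with hC
  have hC0 : 0 < C := by positivity
  refine ⟨M * C, by positivity, 3, by norm_num, ?_⟩
  intro k hk n hn
  have hk3 : (3:ℝ) ≤ k := by exact_mod_cast hk
  have hk0 : (0:ℝ) < k := by linarith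
  have hn0 : (0:ℝ) ≤ n := n.cast_nonneg
  obtain ⟨hκ0, hκz, hκc⟩ := hκ n k (by omega)
  obtain ⟨hf0, hfn, hfe⟩ := hF n ((k:ℝ) - 3/4) hn0 (by linarith) (fun h => by linarith [h.2])
  generalize F (n:ℝ) ((k:ℝ) - 3/4) = f at *
  generalize κ n k = x at *
  -- the case distinction on the size of the order
  have hbig : ∀ y : ℝ, k * (π/2) ≤ wf n y → (n:ℝ) ≤ B * wf n y := by
    intro y hy
    calc (n:ℝ) ≤ c * k := hn
      _ = B * (k * (π/2)) := by rw [hB]; field_simp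
      _ ≤ _ := by gcongr
  -- f
  have hfx : xi n f = π * (k - 3/4) := by rw [hfe, xi_gfun n f hf0]
  have hfC : f^2 ≤ M^2 * (f^2 - (n:ℝ)^2) := by
    apply cond_of hf0 hfn (hbig f _)
    have := xi_le_wf n f
    rw [hfx] at this
    nlinarith
  -- phases
  obtain ⟨α, a1, a2, a3, a4⟩ := alpha_n n
  obtain ⟨ψ, p1, p2⟩ := psi_exists n α a1 a2 a4
  obtain ⟨Θ, t1, t2⟩ := theta_exists σ hσ n α a1 a2 a3
  obtain ⟨hnx, hΘ⟩ := t2 x hκ0 hκz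
  rw [hκc] at hΘ
  obtain ⟨b1, b2⟩ := at_zero σ n α ψ Θ x hnx (k-1) (a2 x hκ0) (p1 x hnx).1 (t1 x hκ0).1 (p1 x hnx).2.1
    (t1 x hκ0).2 hΘ
  rw [Nat.cast_sub (by omega), Nat.cast_one] at b1 b2
  have up := psi_upper n ψ (fun y hy => (p1 y hy).2.2) p2 x hnx
  have hw : (k - 5/4) * π ≤ wf n x := by
    have := (abs_lt.1 b1).1
    have := xi_le_wf n x
    linarith
  have hxC : x^2 ≤ M^2 * (x^2 - (n:ℝ)^2) := by
    apply cond_of hκ0 hnx.le (hbig x _)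
    nlinarith
  have hwx : wf n x ≤ x := by
    apply le_of_sq_le_sq _ hκ0.le
    rw [wf_sq hnx]; nlinarith
  have hkx : (k:ℝ) ≤ x := by nlinarith
  have lo := psi_lower n ψ (fun y hy => (p1 y hy).2.2) p2 M hM x hκ0 hxC
  have hw0 := wf_pos hnx
  have b3 : |ψ x - (k - 1) * π| ≤ (σ + M^2/2) * M / x := by
    refine b2.trans ?_
    rw [abs_div, abs_of_pos hw0, div_le_div_iff₀ hw0 hκ0]
    have r1 := cond_r hM hκ0 hxC
    have r2 := cond_w hM hκ0 hxC
    have r3 : |σ - rf n x| ≤ σ + M^2/2 := by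
      have := sq_nonneg M
      rw [abs_le]; constructor <;> linarith
    calc |σ - rf n x| * x ≤ (σ + M^2/2) * (M * wf n x) := by gcongr
      _ = _ := by ring
  have hdiff : |xi n x - xi n f| ≤ C / k := by
    have h1 : |xi n x - xi n f| ≤ C / x := by
      rw [hfx]
      have h5 : C / x = (σ + M^2/2) * M / x + 2 * M^5 / x := by rw [hC, add_div]
      have h6 : 0 ≤ 2 * M^5 / x := by positivity
      rw [abs_le] at b3
      rw [h5, abs_le]
      constructor <;> linarith
    exact h1.trans (by gcongr)
  have hfin : |x - f| ≤ M * |xi n x - xi n f| := by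
    rcases le_total x f with h | h
    · have := xi_low hM hκ0 hxC h
      rw [abs_of_nonpos (by linarith), abs_sub_comm]
      have h2 := le_abs_self (xi n f - xi n x)
      have := mul_le_mul_of_nonneg_left h2 (by linarith : 0 ≤ M)
      linarith
    · have := xi_low hM hf0 hfC h
      rw [abs_of_nonneg (by linarith)]
      have h2 := le_abs_self (xi n x - xi n f)
      have := mul_le_mul_of_nonneg_left h2 (by linarith : 0 ≤ M)
      linarith
  calc |x - f| ≤ M * |xi n x - xi n f| := hfin
    _ ≤ M * (C / k) := by gcongr
    _ = M * C / k := by ring
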